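/- arXiv:0710.3032 — 4 statements merged into one kernel-verified Lean document; each statement's English description precedes it below -/
import Mathlib

section
/- Let J be an r-partite k-chain with vertex sets E_1,…,E_r that contains, for each A ⊆ [r] of size at most k, a copy of the double octahedron of dimension |A|, and let 0 < ε ≤ |J|^{−1}. Let X_1,…,X_r be finite sets and for each A ⊆ [r] of size at most k let P(A) be a partition of K(A) into n_A sets. Then there are refinements Q(A) of the partitions P(A), with Q(A) = P(A) when |A| = k, such that, with the chains H(x) defined from the system Q: if x is a uniformly random element of X_1×…×X_r then the probability that H(x) is (ε,J,k)-quasirandom is at least 1−ε; moreover, the number m_A of sets in each partition Q(A) is bounded by a function of ε, J, k and the numbers n_C only. (Theorem 7.3, the regularity lemma for r-partite chains.) -/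
open Finset

open scoped Classical

variable {r : ℕ}

/-- A finite family `H` of finite subsets of `X` is an `r`-partite chain with respect to the
part map `px : X → Fin r` if every edge meets each part at most once and `H` is closed under
taking subsets. -/
def IsPartiteChain {X : Type*} (px : X → Fin r) (H : Finset (Finset X)) : Prop :=
  (∀ A ∈ H, Set.InjOn px ↑A) ∧ (∀ A ∈ H, ∀ B ⊆ A, B ∈ H)

/-- `hstar px H S` is `H_*(S)`: the collection of partite sets of index `S` all of whose
proper subsets are edges of `H`. -/
noncomputable def hstar {X : Type*} [Fintype X] [DecidableEq X] (px : X → Fin r)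
    (H : Finset (Finset X)) (S : Finset (Fin r)) : Finset (Finset X) :=
  univ.filter fun D : Finset X => Set.InjOn px ↑D ∧ D.image px = S ∧ ∀ C ⊂ D, C ∈ H

/-- The relative density `δ_S = |H(S)|/|H_*(S)|` of the edges of `H` of index `S`. -/
noncomputable def relDensity {X : Type*} [Fintype X] [DecidableEq X] (px : X → Fin r)
    (H : Finset (Finset X)) (S : Finset (Fin r)) : ℝ :=
  ((H.filter fun F => F.image px = S).card : ℝ) / ((hstar px H S).card : ℝ)

/-- `oct px S g` is `Oct(g)` for a function `g` of partite sets of index `S`: the expectation,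
over independent uniform choices of `x i 0, x i 1` in the part over `i` for each `i ∈ S`, of
`∏_{ε ∈ {0,1}^S} g {x i (ε i) : i ∈ S}`. -/
noncomputable def oct {X : Type*} [Fintype X] [DecidableEq X] (px : X → Fin r)
    (S : Finset (Fin r)) (g : Finset X → ℝ) : ℝ :=
  (∑ x0 : {i // i ∈ S} → X, ∑ x1 : {i // i ∈ S} → X,
      if ∀ i : {i // i ∈ S}, px (x0 i) = (i : Fin r) ∧ px (x1 i) = (i : Fin r) then
        ∏ T ∈ S.powerset,
          g (S.attach.image fun i : {i // i ∈ S} => if (i : Fin r) ∈ T then x1 i else x0 i)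
      else 0) /
    ∏ i ∈ S, ((univ.filter fun x : X => px x = i).card : ℝ) ^ 2

/-- `∏_{C ⊆ S} δ_C^{2^{|C|}}`, the expected octahedron count. -/
noncomputable def octNorm {X : Type*} [Fintype X] [DecidableEq X] (px : X → Fin r)
    (H : Finset (Finset X)) (S : Finset (Fin r)) : ℝ :=
  ∏ C ∈ S.powerset, relDensity px H C ^ 2 ^ C.card

/-- The function equal to `H^S − δ_S` on `H_*(S)` and `0` elsewhere. -/
noncomputable def devFun {X : Type*} [Fintype X] [DecidableEq X] (px : X → Fin r)
    (H : Finset (Finset X)) (S : Finset (Fin r)) : Finset X → ℝ := fun F =>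
  if F ∈ hstar px H S then (if F ∈ H then 1 else 0) - relDensity px H S else 0

/-- `∏_{A ∈ J, |A| ≥ m} δ_A`, the densities being those of `H` at the indices of the sets
of `J`. -/
noncomputable def prodDelta {E X : Type*} [Fintype X] [DecidableEq X] [DecidableEq E]
    (px : X → Fin r) (H : Finset (Finset X)) (pe : E → Fin r) (J : Finset (Finset E))
    (m : ℕ) : ℝ :=
  ∏ A ∈ J.filter fun A => m ≤ A.card, relDensity px H (A.image pe)

/-- The sequence `ε_k, ε_{k−1}, …` from the definition of quasirandom chains:
`epsSeq ε k nJ P j = ε_{k−j}`, where `nJ = |J|` and `P m = ∏_{A ∈ J, |A| ≥ m} δ_A`. -/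
noncomputable def epsSeq (ε : ℝ) (k nJ : ℕ) (P : ℕ → ℝ) : ℕ → ℝ
  | 0 => ε
  | j + 1 =>
      ((2 : ℝ) ^ ((j + 1) * k + 1))⁻¹ * (nJ : ℝ)⁻¹ *
        (epsSeq ε k nJ P j * P (k - j)) ^ 2 ^ ((j + 1) * k)

/-- The sequence `η_{k−j} = (1/2)·(ε_{k−j}·∏_{A ∈ J, |A| ≥ k−j} δ_A)^{2^{k(j+1)}}`. -/
noncomputable def etaSeq (ε : ℝ) (k nJ : ℕ) (P : ℕ → ℝ) (j : ℕ) : ℝ :=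
  (1 / 2) * (epsSeq ε k nJ P j * P (k - j)) ^ 2 ^ (k * (j + 1))

/-- The chain `H` is `(ε, J, k)`-quasirandom: for every `A ∈ J` of size `j ≤ k`, the
`A`-function equal to `H^A − δ_A` on `H_*(A)` and `0` elsewhere satisfies
`Oct ≤ η_j · ∏_{C ⊆ i(A)} δ_C^{2^{|C|}}`. -/
noncomputable def ChainQuasirandom {E X : Type*} [Fintype X] [DecidableEq X] [DecidableEq E]
    (ε : ℝ) (k : ℕ) (pe : E → Fin r) (J : Finset (Finset E))
    (px : X → Fin r) (H : Finset (Finset X)) : Prop :=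
  ∀ A ∈ J, A.card ≤ k →
    oct px (A.image pe) (devFun px H (A.image pe)) ≤
      etaSeq ε k J.card (fun m => prodDelta px H pe J m) (k - A.card) *
        octNorm px H (A.image pe)

/-- The finite set of `r`-partite maps from `(E, pe)` to `(X, px)`. -/
noncomputable def partiteMaps {E X : Type*} [Fintype E] [DecidableEq E] [Fintype X]
    (pe : E → Fin r) (px : X → Fin r) : Finset (E → X) :=
  univ.filter fun φ => ∀ e, px (φ e) = pe e

/-- The double octahedron of dimension `s`: the chain on the vertex set `Fin s × Fin 3`
(with parts `V i = {i} × {0,1,2}` and levels `B j = [s] × {j}`) whose edges are the sets `B`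
of size at most `s − 1` meeting each `V i` at most once and such that at least one of
`B ∩ B₁` and `B ∩ B₂` is empty. -/
def doubleOct (s : ℕ) : Finset (Finset (Fin s × Fin 3)) :=
  univ.filter fun B : Finset (Fin s × Fin 3) =>
    B.card ≤ s - 1 ∧ (∀ i : Fin s, (B.filter fun p => p.1 = i).card ≤ 1) ∧
      ((B.filter fun p => p.2 = 1) = ∅ ∨ (B.filter fun p => p.2 = 2) = ∅)

/-- `K(A)`: the complete hypergraph of all partite subsets of `X` of index exactly `A`. -/
noncomputable def completeK {r : ℕ} {X : Type*} [Fintype X] [DecidableEq X] (px : X → Fin r)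
    (A : Finset (Fin r)) : Finset (Finset X) :=
  univ.filter fun F : Finset X => Set.InjOn px ↑F ∧ F.image px = A

/-- Given a system of partitions of the complete hypergraphs `K(A)` (presented as colourings
`Q A : Finset X → ℕ`) and a point `x ∈ X_1 × ⋯ × X_r`, the chain `H(x)`: all partite sets `B`
of size at most `k` that are strongly equivalent to `x(A)` where `A` is the index of `B`,
i.e. such that for every `C ⊆ A` the subset of `B` of index `C` gets the same colour as
`{x i : i ∈ C}`. -/
noncomputable def chainOf {r : ℕ} {X : Type*} [Fintype X] [DecidableEq X] (px : X → Fin r)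
    (k : ℕ) (Q : Finset (Fin r) → Finset X → ℕ) (x : Fin r → X) : Finset (Finset X) :=
  univ.filter fun B : Finset X => Set.InjOn px ↑B ∧ B.card ≤ k ∧
    ∀ C ⊆ B.image px, Q C (B.filter fun v => px v ∈ C) = Q C (C.image x)


set_option linter.unusedSectionVars false

open scoped BigOperators

section Points

variable {X W : Type*} [Fintype X] [DecidableEq X] [Fintype W] [DecidableEq W]

lemma mem_partiteMaps {px : X → Fin r} {π : W → Fin r} {y : W → X} :
    y ∈ partiteMaps π px ↔ ∀ w, px (y w) = π w := by
  simp [partiteMaps]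

/-- The points of `X_1 × ⋯ × X_r`. -/
noncomputable abbrev points (px : X → Fin r) : Finset (Fin r → X) := partiteMaps id px

lemma image_inj_of_mem_points {px : X → Fin r} {x x' : Fin r → X} (hx : x ∈ points px)
    (hx' : x' ∈ points px) {D : Finset (Fin r)} (h : D.image x = D.image x') :
    ∀ i ∈ D, x i = x' i := by
  intro i hi
  have : x i ∈ D.image x' := h ▸ mem_image_of_mem x hi
  obtain ⟨j, -, hj⟩ := mem_image.1 this
  have h1 := mem_partiteMaps.1 hx i
  have h2 := mem_partiteMaps.1 hx' j
  rw [hj, h1] at h2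
  simp only [id] at h2
  rw [← hj, h2]

/-- Replace the values of `y` on `B` by those prescribed by the point `x`. -/
def splice (π : W → Fin r) (B : Finset W) (x : Fin r → X) (y : W → X) : W → X :=
  fun w => if w ∈ B then x (π w) else y w

lemma splice_mem {px : X → Fin r} {π : W → Fin r} {B : Finset W} {x : Fin r → X} {y : W → X}
    (hx : x ∈ points px) (hy : y ∈ partiteMaps π px) : splice π B x y ∈ partiteMaps π px := by
  rw [mem_partiteMaps] at *
  intro w
  unfold splice
  split_ifs
  · exact hx _
  · exact hy _

lemma image_splice {π : W → Fin r} {B B' : Finset W} (h : B' ⊆ B) (x : Fin r → X) (y : W → X) :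
    B'.image (splice π B x y) = (B'.image π).image x := by
  rw [image_image]
  exact image_congr fun w hw => by simp [splice, h hw]

lemma expect_splice {px : X → Fin r} (hne : (points px).Nonempty) {π : W → Fin r}
    {B : Finset W} (hB : Set.InjOn π ↑B) (F : (W → X) → ℝ) :
    𝔼 y ∈ partiteMaps π px, F y =
      𝔼 x ∈ points px, 𝔼 y ∈ partiteMaps π px, F (splice π B x y) := by
  let back : (Fin r → X) → (W → X) → Fin r → X := fun x y i =>
    if h : ∃ w ∈ B, π w = i then y h.choose else x i
  have back_apply : ∀ x y w, w ∈ B → back x y (π w) = y w := by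
    intro x y w hw
    have h : ∃ w' ∈ B, π w' = π w := ⟨w, hw, rfl⟩
    simp only [back, dif_pos h]
    rw [hB h.choose_spec.1 hw h.choose_spec.2]
  have back_mem : ∀ x ∈ points px, ∀ y ∈ partiteMaps π px, back x y ∈ points px := by
    intro x hx y hy
    rw [mem_partiteMaps] at *
    intro i
    simp only [back]
    split_ifs with h
    · rw [hy, h.choose_spec.2]; rfl
    · exact hx i
  have h1 : 𝔼 y ∈ partiteMaps π px, F y =
      𝔼 p ∈ points px ×ˢ partiteMaps π px, F p.2 := by
    rw [expect_product' (f := fun _ y => F y), expect_const hne]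
  rw [h1, ← expect_product' (f := fun x y => F (splice π B x y))]
  have invol : ∀ x y, back (back x y) (splice π B x y) = x ∧
      splice π B (back x y) (splice π B x y) = y := by
    intro x y
    constructor
    · funext i
      by_cases h : ∃ w ∈ B, π w = i
      · obtain ⟨w, hw, rfl⟩ := h
        rw [back_apply _ _ _ hw]
        simp [splice, hw]
      · simp [back, h]
    · funext w
      by_cases hw : w ∈ B
      · simp only [splice, if_pos hw, back_apply _ _ _ hw]
      · simp [splice, hw]
  refine expect_nbij' (fun p => (back p.1 p.2, splice π B p.1 p.2))
    (fun p => (back p.1 p.2, splice π B p.1 p.2)) ?_ ?_ ?_ ?_ ?_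
  · rintro ⟨x, y⟩ h
    rw [mem_product] at *
    exact ⟨back_mem _ h.1 _ h.2, splice_mem h.1 h.2⟩
  · rintro ⟨x, y⟩ h
    rw [mem_product] at *
    exact ⟨back_mem _ h.1 _ h.2, splice_mem h.1 h.2⟩
  · rintro ⟨x, y⟩ -
    exact Prod.ext (invol x y).1 (invol x y).2
  · rintro ⟨x, y⟩ -
    exact Prod.ext (invol x y).1 (invol x y).2
  · rintro ⟨x, y⟩ -
    exact congrArg F (invol x y).2.symm

end Points

section CondExp

variable {Ω β γ : Type*} {s : Finset Ω}

/-- The average of `g` over the cell of `x` in the partition of `s` into the fibres of `φ`. -/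
noncomputable def cellAvg (s : Finset Ω) (φ : Ω → β) (g : Ω → ℝ) (x : Ω) : ℝ :=
  𝔼 y ∈ s with φ y = φ x, g y

lemma cellAvg_congr {φ : Ω → β} {g : Ω → ℝ} {x y : Ω} (h : φ x = φ y) :
    cellAvg s φ g x = cellAvg s φ g y := by
  simp [cellAvg, h]

lemma cellAvg_nonneg {φ : Ω → β} {g : Ω → ℝ} (hg : ∀ x, 0 ≤ g x) (x : Ω) :
    0 ≤ cellAvg s φ g x := expect_nonneg fun y _ => hg y

lemma cellAvg_le_one {φ : Ω → β} {g : Ω → ℝ} (hg : ∀ x, g x ≤ 1) {x : Ω} (hx : x ∈ s) :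
    cellAvg s φ g x ≤ 1 :=
  expect_le ⟨x, by simp [hx]⟩ fun y _ => hg y

lemma expect_cellAvg_mul {φ : Ω → β} {g w : Ω → ℝ}
    (hw : ∀ x ∈ s, ∀ y ∈ s, φ x = φ y → w x = w y) :
    𝔼 x ∈ s, cellAvg s φ g x * w x = 𝔼 x ∈ s, g x * w x := by
  rw [expect_eq_sum_div_card, expect_eq_sum_div_card]
  congr 1
  have h1 : ∀ x ∈ s, cellAvg s φ g x * w x =
      ∑ y ∈ s, if φ y = φ x then g y * w y / (#{z ∈ s | φ z = φ y} : ℝ) else 0 := by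
    intro x hx
    rw [cellAvg, expect_eq_sum_div_card, sum_div, sum_mul, sum_filter]
    refine sum_congr rfl fun y hy => ?_
    split_ifs with h
    · rw [hw y hy x hx h, h]; ring
    · rfl
  rw [sum_congr rfl h1, sum_comm]
  refine sum_congr rfl fun y hy => ?_
  rw [← sum_filter, sum_const, nsmul_eq_mul]
  have h2 : (#{z ∈ s | φ z = φ y} : ℝ) ≠ 0 := by
    have : 0 < #{z ∈ s | φ z = φ y} := card_pos.2 ⟨y, by simp [hy]⟩
    positivity
  have h3 : #{z ∈ s | φ y = φ z} = #{z ∈ s | φ z = φ y} := by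
    congr 1; ext; simp [eq_comm]
  rw [h3]
  field_simp

lemma expect_cellAvg {φ : Ω → β} {g : Ω → ℝ} :
    𝔼 x ∈ s, cellAvg s φ g x = 𝔼 x ∈ s, g x := by
  simpa using expect_cellAvg_mul (s := s) (φ := φ) (g := g) (w := fun _ => 1) (by simp)

lemma expect_cellAvg_sq_of_refines {φ : Ω → β} {φ' : Ω → γ} {g : Ω → ℝ}
    (h : ∀ x ∈ s, ∀ y ∈ s, φ' x = φ' y → φ x = φ y) :
    𝔼 x ∈ s, (cellAvg s φ' g x - cellAvg s φ g x) ^ 2 =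
      𝔼 x ∈ s, cellAvg s φ' g x ^ 2 - 𝔼 x ∈ s, cellAvg s φ g x ^ 2 := by
  have h1 : 𝔼 x ∈ s, cellAvg s φ' g x * cellAvg s φ g x = 𝔼 x ∈ s, g x * cellAvg s φ g x :=
    expect_cellAvg_mul fun x hx y hy hxy => cellAvg_congr (h x hx y hy hxy)
  have h2 : 𝔼 x ∈ s, cellAvg s φ g x * cellAvg s φ g x = 𝔼 x ∈ s, g x * cellAvg s φ g x :=
    expect_cellAvg_mul fun x _ y _ hxy => cellAvg_congr hxy
  have h3 : ∀ x, (cellAvg s φ' g x - cellAvg s φ g x) ^ 2 = cellAvg s φ' g x ^ 2 -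
      cellAvg s φ' g x * cellAvg s φ g x - (cellAvg s φ' g x * cellAvg s φ g x -
        cellAvg s φ g x * cellAvg s φ g x) := fun x => by ring
  simp only [h3, expect_sub_distrib, h1, h2, sub_self, sub_zero]
  simp only [← h2, sq]

/-- If `g` minus its projection correlates with a bounded function that is constant on the
cells of a finer partition, then the finer projection has larger energy. -/
lemma energy_increment {φ : Ω → β} {φ' : Ω → γ} {g w : Ω → ℝ} {θ : ℝ} (hθ : 0 ≤ θ)
    (hs : s.Nonempty)
    (h : ∀ x ∈ s, ∀ y ∈ s, φ' x = φ' y → φ x = φ y)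
    (hw : ∀ x ∈ s, ∀ y ∈ s, φ' x = φ' y → w x = w y) (hw1 : ∀ x, |w x| ≤ 1)
    (hc : θ ≤ 𝔼 x ∈ s, (g x - cellAvg s φ g x) * w x) :
    𝔼 x ∈ s, cellAvg s φ g x ^ 2 + θ ^ 2 ≤ 𝔼 x ∈ s, cellAvg s φ' g x ^ 2 := by
  have h1 := expect_cellAvg_mul (g := g) hw
  have h2 : 𝔼 x ∈ s, (g x - cellAvg s φ g x) * w x =
      𝔼 x ∈ s, (cellAvg s φ' g x - cellAvg s φ g x) * w x := by
    simp only [sub_mul, expect_sub_distrib, h1]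
  have h3 := expect_mul_sq_le_sq_mul_sq s (fun x => cellAvg s φ' g x - cellAvg s φ g x) w
  have h4 : 𝔼 x ∈ s, w x ^ 2 ≤ 1 := expect_le hs fun x _ => by
    rw [← sq_abs]; exact pow_le_one₀ (abs_nonneg _) (hw1 x)
  have h5 : 0 ≤ 𝔼 x ∈ s, (cellAvg s φ' g x - cellAvg s φ g x) ^ 2 :=
    expect_nonneg fun x _ => sq_nonneg _
  have h6 := expect_cellAvg_sq_of_refines (g := g) h
  rw [← h2] at h3
  have h7 : θ ^ 2 ≤ (𝔼 x ∈ s, (g x - cellAvg s φ g x) * w x) ^ 2 := pow_le_pow_left₀ hθ hc 2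
  nlinarith [mul_le_mul_of_nonneg_left h4 h5]

end CondExp

section Copies

variable {X W : Type*} [Fintype X] [DecidableEq X] [Fintype W] [DecidableEq W]

/-- The indicator that the `B`-face of `y` has the same colour as the corresponding face of the
point `x₀`. -/
noncomputable def agree (Q : Finset (Fin r) → Finset X → ℕ) (x₀ : Fin r → X) (π : W → Fin r)
    (B : Finset W) (y : W → X) : ℝ :=
  if Q (B.image π) (B.image y) = Q (B.image π) ((B.image π).image x₀) then 1 else 0

/-- The density of those partite maps all of whose faces in `K` agree with `x₀`. -/
noncomputable def copies (px : X → Fin r) (Q : Finset (Fin r) → Finset X → ℕ) (x₀ : Fin r → X)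
    (π : W → Fin r) (K : Finset (Finset W)) : ℝ :=
  𝔼 y ∈ partiteMaps π px, ∏ B ∈ K, agree Q x₀ π B y

/-- The relative density at `C` of the chain of `x₀`. -/
noncomputable def faceDensity (px : X → Fin r) (Q : Finset (Fin r) → Finset X → ℕ)
    (x₀ : Fin r → X) (C : Finset (Fin r)) : ℝ :=
  copies px Q x₀ id C.powerset / copies px Q x₀ id C.ssubsets

/-- `u` has correlation at most `θ` with products of bounded functions each of which ignores
some coordinate in `C` and all coordinates outside `C`. -/
def CutUniform (px : X → Fin r) (C : Finset (Fin r)) (u : (Fin r → X) → ℝ) (θ : ℝ) : Prop :=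
  ∀ w : Fin r → (Fin r → X) → ℝ, (∀ i x, |w i x| ≤ 1) →
    (∀ i ∈ C, DependsOn (w i) ((C.erase i : Finset (Fin r)) : Set (Fin r))) →
      |𝔼 x ∈ points px, u x * ∏ i ∈ C, w i x| ≤ θ

variable {px : X → Fin r} {Q : Finset (Fin r) → Finset X → ℕ} {x₀ : Fin r → X} {π : W → Fin r}

lemma CutUniform.abs_expect_mul_prod_le {C : Finset (Fin r)} {u : (Fin r → X) → ℝ} {θ : ℝ}
    (hu : CutUniform px C u θ) {κ : Type*} (K : Finset κ) (φ : κ → (Fin r → X) → ℝ)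
    (hφ : ∀ b ∈ K, ∀ x, |φ b x| ≤ 1)
    (hdep : ∀ b ∈ K, ∃ i ∈ C, DependsOn (φ b) ((C.erase i : Finset (Fin r)) : Set (Fin r))) :
    |𝔼 x ∈ points px, u x * ∏ b ∈ K, φ b x| ≤ θ := by
  rcases K.eq_empty_or_nonempty with rfl | ⟨b₀, hb₀⟩
  · simpa using hu (fun _ _ => 1) (by simp) fun i _ => fun x y _ => rfl
  have : Nonempty (Fin r) := ⟨(hdep b₀ hb₀).choose⟩
  choose! ι hιC hι using hdep
  have h := hu (fun i x => ∏ b ∈ K with ι b = i, φ b x) ?_ ?_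
  · simpa only [prod_fiberwise_of_maps_to hιC] using h
  · intro i x
    rw [abs_prod]
    exact prod_le_one (fun _ _ => abs_nonneg _) fun b hb => hφ b (mem_filter.1 hb).1 x
  · intro i _ x y hxy
    refine prod_congr rfl fun b hb => ?_
    obtain ⟨hb', rfl⟩ := mem_filter.1 hb
    exact hι b hb' hxy

lemma agree_nonneg (B : Finset W) (y : W → X) : 0 ≤ agree Q x₀ π B y := by
  unfold agree; split_ifs <;> norm_num

lemma agree_le_one (B : Finset W) (y : W → X) : agree Q x₀ π B y ≤ 1 := by
  unfold agree; split_ifs <;> norm_num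

lemma abs_agree_le_one (B : Finset W) (y : W → X) : |agree Q x₀ π B y| ≤ 1 := by
  rw [abs_of_nonneg (agree_nonneg _ _)]; exact agree_le_one _ _

lemma agree_eq_zero_or_one (B : Finset W) (y : W → X) :
    agree Q x₀ π B y = 0 ∨ agree Q x₀ π B y = 1 := by
  unfold agree; split_ifs <;> simp

lemma dependsOn_agree (B : Finset W) : DependsOn (agree Q x₀ π B) (B : Set W) := by
  intro y y' h
  unfold agree
  rw [show B.image y = B.image y' from image_congr h]

lemma prod_agree_eq_zero_or_one (K : Finset (Finset W)) (y : W → X) :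
    ∏ B ∈ K, agree Q x₀ π B y = 0 ∨ ∏ B ∈ K, agree Q x₀ π B y = 1 := by
  unfold agree
  rw [prod_boole]; split_ifs <;> simp

lemma prod_agree_nonneg (K : Finset (Finset W)) (y : W → X) :
    0 ≤ ∏ B ∈ K, agree Q x₀ π B y := prod_nonneg fun _ _ => agree_nonneg _ _

lemma prod_agree_le_one (K : Finset (Finset W)) (y : W → X) :
    ∏ B ∈ K, agree Q x₀ π B y ≤ 1 :=
  prod_le_one (fun _ _ => agree_nonneg _ _) fun _ _ => agree_le_one _ _

lemma copies_nonneg (K : Finset (Finset W)) : 0 ≤ copies px Q x₀ π K :=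
  expect_nonneg fun y _ => prod_agree_nonneg K y

lemma copies_pos (hx₀ : x₀ ∈ points px) (K : Finset (Finset (Fin r))) :
    0 < copies px Q x₀ id K :=
  expect_pos' (fun y _ => prod_agree_nonneg K y) ⟨x₀, hx₀, by simp [agree]⟩

lemma faceDensity_nonneg (C : Finset (Fin r)) : 0 ≤ faceDensity px Q x₀ C :=
  div_nonneg (copies_nonneg _) (copies_nonneg _)

lemma faceDensity_le_one (C : Finset (Fin r)) : faceDensity px Q x₀ C ≤ 1 := by
  refine div_le_one_of_le₀ (expect_le_expect fun y _ => ?_) (copies_nonneg _)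
  rw [← prod_erase_mul _ _ (mem_powerset_self C)]
  exact mul_le_of_le_one_right (prod_agree_nonneg _ _) (agree_le_one _ _)

lemma agree_splice {B B' : Finset W} (h : B' ⊆ B) (x : Fin r → X) (y : W → X) :
    agree Q x₀ π B' (splice π B x y) = agree Q x₀ id (B'.image π) x := by
  simp [agree, image_splice h]

/-- The map of `W` into two copies of `W` glued along `B` that lands in the second copy. -/
def glue (B : Finset W) (w : W) : W ⊕ W := if w ∈ B then Sum.inl w else Sum.inr w

lemma glue_injective (B : Finset W) : Function.Injective (glue B) := by
  intro w w' h
  unfold glue at h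
  split_ifs at h <;> simp_all

lemma sumElim_glue (B : Finset W) (π : W → Fin r) : Sum.elim π π ∘ glue B = π := by
  funext w; simp only [Function.comp, glue]; split_ifs <;> rfl

/-- Two copies of the edge set `K` glued along the vertex set `B`. -/
def doubleAlong (B : Finset W) (K : Finset (Finset W)) : Finset (Finset (W ⊕ W)) :=
  K.image (fun B' => B'.image Sum.inl) ∪ K.image (fun B' => B'.image (glue B))

lemma expect_sq_expect_splice (hne : (points px).Nonempty) {B : Finset W}
    (hB : Set.InjOn π ↑B) (K : Finset (Finset W)) :
    𝔼 x ∈ points px, (𝔼 y ∈ partiteMaps π px, ∏ B' ∈ K, agree Q x₀ π B' (splice π B x y)) ^ 2 =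
      copies px Q x₀ (Sum.elim π π) (doubleAlong B K) := by
  have hprod : ∀ z : W ⊕ W → X, ∏ B' ∈ doubleAlong B K, agree Q x₀ (Sum.elim π π) B' z =
      (∏ B' ∈ K, agree Q x₀ π B' (z ∘ Sum.inl)) *
        ∏ B' ∈ K, agree Q x₀ π B' (z ∘ glue B) := by
    intro z
    have h1 : ∀ B' : Finset W, (B'.image (glue B)).image (Sum.elim π π) = B'.image π := by
      intro B'; rw [image_image, sumElim_glue]
    have h2 : ∀ B' : Finset W,
        (B'.image (Sum.inl : W → W ⊕ W)).image (Sum.elim π π) = B'.image π := by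
      intro B'; rw [image_image]; rfl
    simp only [agree, prod_boole, doubleAlong, forall_mem_union, forall_mem_image, h1, h2]
    simp only [image_image, ← ite_and, mul_ite, mul_one, mul_zero]
    split_ifs <;> simp_all
  have hmix : 𝔼 z ∈ partiteMaps (Sum.elim π π) px,
      ∏ B' ∈ doubleAlong B K, agree Q x₀ (Sum.elim π π) B' z =
      𝔼 y ∈ partiteMaps π px, 𝔼 y' ∈ partiteMaps π px,
        (∏ B' ∈ K, agree Q x₀ π B' y) *
          ∏ B' ∈ K, agree Q x₀ π B' (fun w => if w ∈ B then y w else y' w) := by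
    rw [← expect_product' (f := fun y y' : W → X => (∏ B' ∈ K, agree Q x₀ π B' y) *
          ∏ B' ∈ K, agree Q x₀ π B' (fun w => if w ∈ B then y w else y' w))]
    refine expect_nbij' (fun z => (z ∘ Sum.inl, z ∘ Sum.inr)) (fun p => Sum.elim p.1 p.2)
      ?_ ?_ ?_ ?_ ?_
    · intro z hz
      rw [mem_product, mem_partiteMaps, mem_partiteMaps]
      rw [mem_partiteMaps] at hz
      exact ⟨fun w => hz (Sum.inl w), fun w => hz (Sum.inr w)⟩
    · intro p hp
      rw [mem_product, mem_partiteMaps, mem_partiteMaps] at hp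
      rw [mem_partiteMaps]
      rintro (w | w)
      exacts [hp.1 w, hp.2 w]
    · intro z _
      exact Sum.elim_comp_inl_inr z
    · intro p _
      simp
    · intro z _
      rw [hprod]
      congr 3
      funext B'
      congr 1
      funext w
      simp only [Function.comp, glue]
      split_ifs <;> rfl
  rw [copies, hmix, expect_splice hne hB]
  refine expect_congr rfl fun x _ => ?_
  rw [sq, expect_mul_expect]
  refine expect_congr rfl fun y _ => expect_congr rfl fun y' _ => ?_
  congr 3
  funext B'
  congr 1
  funext w
  simp only [splice]
  split_ifs <;> rfl

/-- A face whose colour class decomposes into a small and a uniform part can be replaced by its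
density in an average over partite maps. -/
theorem expect_deviation_mul_le (hne : (points px).Nonempty) {B : Finset W}
    (hB : Set.InjOn π ↑B) {e u : (Fin r → X) → ℝ} {δ τ θ R : ℝ}
    (hu : CutUniform px (B.image π) u θ)
    (he : 𝔼 x ∈ points px, (∏ D ∈ (B.image π).ssubsets, agree Q x₀ id D x) * e x ^ 2 ≤
      τ * copies px Q x₀ id (B.image π).ssubsets)
    (hdec : ∀ x ∈ points px, ∏ D ∈ (B.image π).ssubsets, agree Q x₀ id D x = 1 →
      agree Q x₀ id (B.image π) x - δ = e x + u x)
    {K : Finset (Finset W)} (hK : B.ssubsets ⊆ K)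
    {κ : Type*} (L : Finset κ) (S : κ → Finset W) (φ : κ → (W → X) → ℝ)
    (hφ : ∀ b ∈ L, ∀ y, |φ b y| ≤ 1) (hdep : ∀ b ∈ L, DependsOn (φ b) (S b : Set W))
    (hS : ∀ b ∈ L, ¬ B ⊆ S b)
    (hL : ∀ y, |∏ b ∈ L, φ b y| ≤ ∏ B' ∈ K, agree Q x₀ π B' y) (hR0 : 0 ≤ R)
    (hR : τ * copies px Q x₀ id (B.image π).ssubsets *
      copies px Q x₀ (Sum.elim π π) (doubleAlong B K) ≤ R ^ 2) :
    𝔼 y ∈ partiteMaps π px, (agree Q x₀ π B y - δ) * ∏ b ∈ L, φ b y ≤ θ + R := by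
  set h : (Fin r → X) → ℝ := fun x => ∏ D ∈ (B.image π).ssubsets, agree Q x₀ id D x with hh
  set Φ : (W → X) → ℝ := fun y => ∏ b ∈ L, φ b y with hΦ
  set Ψ : (W → X) → ℝ := fun y => ∏ B' ∈ K, agree Q x₀ π B' y with hΨ
  have hΨ0 : ∀ y, 0 ≤ Ψ y := fun y => prod_agree_nonneg K y
  have hvanish : ∀ x y, h x = 0 → Ψ (splice π B x y) = 0 := by
    intro x y hx
    obtain ⟨D, hD, hD0⟩ := prod_eq_zero_iff.1 hx
    have hDC := mem_ssubsets.1 hD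
    obtain ⟨B', hB'B, rfl⟩ := subset_image_iff.1 (hDC.1)
    have hss : B' ∈ B.ssubsets := by
      rw [mem_ssubsets]
      exact ⟨by exact_mod_cast hB'B, fun hsub => hDC.2 (image_subset_image hsub)⟩
    refine prod_eq_zero (hK hss) ?_
    rw [agree_splice (mem_ssubsets.1 hss).1, hD0]
  have h01 : ∀ x, h x = 0 ∨ h x = 1 := fun x => prod_agree_eq_zero_or_one _ _
  have hrew : 𝔼 y ∈ partiteMaps π px, (agree Q x₀ π B y - δ) * Φ y =
      𝔼 x ∈ points px, 𝔼 y ∈ partiteMaps π px, e x * Φ (splice π B x y) +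
      𝔼 y ∈ partiteMaps π px, 𝔼 x ∈ points px, u x * Φ (splice π B x y) := by
    rw [expect_splice hne hB, expect_comm (partiteMaps π px), ← expect_add_distrib]
    refine expect_congr rfl fun x hx => ?_
    rw [← expect_add_distrib]
    refine expect_congr rfl fun y _ => ?_
    rcases h01 x with h0 | h1
    · have hz : Φ (splice π B x y) = 0 := by
        have := (hL (splice π B x y)).trans_eq (hvanish x y h0)
        exact abs_nonpos_iff.1 this
      simp [hz]
    · rw [agree_splice subset_rfl, hdec x hx h1]; ring
  have hupart : 𝔼 y ∈ partiteMaps π px, 𝔼 x ∈ points px, u x * Φ (splice π B x y) ≤ θ := by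
    have hθ : ∀ y : W → X, 𝔼 x ∈ points px, u x * Φ (splice π B x y) ≤ θ := by
      intro y
      refine (le_abs_self _).trans (hu.abs_expect_mul_prod_le L
        (fun b x => φ b (splice π B x y)) (fun b hb x => hφ b hb _) fun b hb => ?_)
      obtain ⟨w₀, hw₀, hw₀S⟩ := not_subset.1 (hS b hb)
      refine ⟨π w₀, mem_image_of_mem _ hw₀, fun x x' hxx' => hdep b hb fun w hw => ?_⟩
      simp only [splice]
      split_ifs with hwB
      · refine hxx' _ ?_
        simp only [coe_erase, coe_image, Set.mem_sdiff, Set.mem_image, mem_coe,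
          Set.mem_singleton_iff]
        refine ⟨⟨w, hwB, rfl⟩, fun hww => hw₀S ?_⟩
        rw [← hB hwB hw₀ hww]
        exact_mod_cast hw
      · rfl
    rcases (partiteMaps π px).eq_empty_or_nonempty with hemp | hT
    · rw [hemp, expect_empty]
      exact (abs_nonneg _).trans (hu (fun _ _ => 0) (by simp) fun i _ => by
        intro x y _; rfl)
    · exact expect_le hT fun y _ => hθ y
  have hepart : 𝔼 x ∈ points px, 𝔼 y ∈ partiteMaps π px, e x * Φ (splice π B x y) ≤ R := by
    set N : (Fin r → X) → ℝ := fun x => 𝔼 y ∈ partiteMaps π px, Ψ (splice π B x y) with hN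
    have hN0 : ∀ x, 0 ≤ N x := fun x => expect_nonneg fun y _ => hΨ0 _
    have h1 : 𝔼 x ∈ points px, 𝔼 y ∈ partiteMaps π px, e x * Φ (splice π B x y) ≤
        𝔼 x ∈ points px, (h x * |e x|) * N x := by
      refine expect_le_expect fun x _ => ?_
      rw [hN, mul_expect]
      refine expect_le_expect fun y _ => ?_
      have h2 : e x * Φ (splice π B x y) ≤ |e x| * Ψ (splice π B x y) := by
        refine (le_abs_self _).trans ?_
        rw [abs_mul]
        exact mul_le_mul_of_nonneg_left (hL _) (abs_nonneg _)
      rcases h01 x with h0 | h1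
      · rw [hvanish x y h0, mul_zero] at h2
        rw [hvanish x y h0, mul_zero]; exact h2
      · rwa [h1, one_mul]
    refine h1.trans (le_of_abs_le (abs_le_of_sq_le_sq ?_ hR0))
    refine (expect_mul_sq_le_sq_mul_sq _ _ _).trans (le_trans ?_ hR)
    rw [← expect_sq_expect_splice hne hB]
    refine mul_le_mul_of_nonneg_right ?_ (expect_nonneg fun x _ => sq_nonneg _)
    refine le_trans (le_of_eq (expect_congr rfl fun x _ => ?_)) he
    rw [mul_pow, sq_abs]
    rcases h01 x with h0 | h1
    · have h0' := h0
      simp only [hh] at h0'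
      rw [h0, h0']; simp
    · have h1' := h1
      simp only [hh] at h1'
      rw [h1, h1']; simp
  rw [hrew]
  linarith

end Copies

section Counting

variable {X : Type*} [Fintype X] [DecidableEq X]

/-- The chain of `x₀` has density at least `c` at `C`, and up to a function of small norm
(`τ` is the bound on its normalised square) its indicator at `C` differs from its density by a
`θ`-uniform function. -/
def RegularAt (px : X → Fin r) (Q : Finset (Fin r) → Finset X → ℕ) (x₀ : Fin r → X)
    (C : Finset (Fin r)) (c τ θ : ℝ) : Prop :=
  c ≤ faceDensity px Q x₀ C ∧ ∃ e u : (Fin r → X) → ℝ, CutUniform px C u θ ∧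
    𝔼 x ∈ points px, (∏ D ∈ C.ssubsets, agree Q x₀ id D x) * e x ^ 2 ≤
      τ * copies px Q x₀ id C.ssubsets ∧
    ∀ x ∈ points px, ∏ D ∈ C.ssubsets, agree Q x₀ id D x = 1 →
      agree Q x₀ id C x - faceDensity px Q x₀ C = e x + u x

/-- Compatibility of the lower bounds `c` for the densities of the levels with the relative
errors `ξ` of the counts and the parameters `τ`, `θ` of regularity. -/
structure Compatible (L : ℕ) (c ξ τ θ : ℕ → ℝ) : Prop where
  mono : Monotone c
  pos : ∀ j, 0 < c j
  le_one : ∀ j, c j ≤ 1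
  err_pos : ∀ j, 0 < ξ j
  err_le : ∀ j, 2 * ξ j ≤ c j ^ L
  sq_nonneg : ∀ j, 0 ≤ τ j
  sq_le : ∀ j, τ j * (2 ^ L * 2 ^ L) ≤ ξ j ^ 2
  cut_le : ∀ j, θ j ≤ ξ j * c 0 ^ L

lemma pow_le_prod_of_le {κ : Type*} {s : Finset κ} {f : κ → ℝ} {a : ℝ} {L : ℕ} (ha : 0 ≤ a)
    (ha1 : a ≤ 1) (hf : ∀ i ∈ s, a ≤ f i) (hL : #s ≤ L) : a ^ L ≤ ∏ i ∈ s, f i :=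
  (pow_le_pow_of_le_one ha ha1 hL).trans (by
    rw [← prod_const]; exact prod_le_prod (fun _ _ => ha) hf)

variable {px : X → Fin r} {Q : Finset (Fin r) → Finset X → ℕ} {x₀ : Fin r → X}

lemma faceDensity_empty (hx₀ : x₀ ∈ points px) : faceDensity px Q x₀ ∅ = 1 := by
  have : (points px).Nonempty := ⟨x₀, hx₀⟩
  have h : (∅ : Finset (Fin r)).ssubsets = ∅ := by ext; simp
  simp [faceDensity, copies, agree, h, expect_const this]

lemma prod_ssubsets_image {W M : Type*} [DecidableEq W] [CommMonoid M] {π : W → Fin r}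
    {B : Finset W} (hB : Set.InjOn π ↑B) (f : Finset (Fin r) → M) :
    ∏ D ∈ (B.image π).ssubsets, f D = ∏ B' ∈ B.ssubsets, f (B'.image π) := by
  refine (prod_nbij (fun B' => B'.image π) ?_ ?_ ?_ ?_).symm
  · intro B' h
    rw [mem_ssubsets] at *
    refine (image_subset_image h.1).ssubset_of_ne fun heq => h.2 fun w hw => ?_
    obtain ⟨w', hw', h'⟩ := mem_image.1 (heq ▸ mem_image_of_mem π hw)
    rwa [← hB (h.1 hw') hw h']
  · intro B' h B'' h' heq
    rw [mem_coe, mem_ssubsets] at h h'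
    have key : ∀ {S T : Finset W}, S ⊆ B → T ⊆ B → S.image π = T.image π → S ⊆ T := by
      intro S T hS hT hST w hw
      obtain ⟨w', hw', h'⟩ := mem_image.1 (hST ▸ mem_image_of_mem π hw)
      rwa [← hB (hT hw') (hS hw) h']
    exact (key h.1 h'.1 heq).antisymm (key h'.1 h.1 heq.symm)
  · intro D hD
    rw [mem_coe, mem_ssubsets] at hD
    obtain ⟨B', hB'B, rfl⟩ := subset_image_iff.1 hD.1
    refine ⟨B', ?_, rfl⟩
    rw [mem_coe, mem_ssubsets]
    exact ⟨by exact_mod_cast hB'B, fun hsub => hD.2 (image_subset_image hsub)⟩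
  · intro B' _; rfl

lemma prod_doubleAlong_mul {W : Type*} [Fintype W] [DecidableEq W] {π : W → Fin r}
    {B : Finset W} (f : Finset (Fin r) → ℝ) {K : Finset (Finset W)} (hK : B.ssubsets ⊆ K)
    (hcard : ∀ B' ∈ K, #B' < #B) :
    (∏ D ∈ doubleAlong B K, f (D.image (Sum.elim π π))) * ∏ B' ∈ B.ssubsets, f (B'.image π) =
      (∏ B' ∈ K, f (B'.image π)) ^ 2 := by
  have hinl : Function.Injective fun B' : Finset W => B'.image (Sum.inl : W → W ⊕ W) :=
    image_injective Sum.inl_injective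
  have hgl : Function.Injective fun B' : Finset W => B'.image (glue B) :=
    image_injective (glue_injective B)
  have hinter : K.image (fun B' => B'.image Sum.inl) ∩ K.image (fun B' => B'.image (glue B)) =
      B.ssubsets.image (fun B' => B'.image Sum.inl) := by
    ext D
    rw [mem_inter, mem_image, mem_image, mem_image]
    constructor
    · rintro ⟨⟨B', hB', rfl⟩, B'', hB'', h⟩
      refine ⟨B', ?_, rfl⟩
      have hsub : B' ⊆ B := by
        intro w hw
        have : (Sum.inl w : W ⊕ W) ∈ B''.image (glue B) := by
          rw [h]; exact mem_image_of_mem _ hw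
        obtain ⟨w', -, hw'⟩ := mem_image.1 this
        unfold glue at hw'
        split_ifs at hw' with hB
        · rwa [← Sum.inl_injective hw']
      rw [mem_ssubsets]
      exact hsub.ssubset_of_ne fun h => (hcard B' hB').ne (by rw [h])
    · rintro ⟨B', hB', rfl⟩
      refine ⟨⟨B', hK hB', rfl⟩, B', hK hB', image_congr fun w hw => ?_⟩
      simp [glue, (mem_ssubsets.1 hB').1 hw]
  have h := prod_union_inter (s₁ := K.image (fun B' => B'.image Sum.inl))
    (s₂ := K.image (fun B' => B'.image (glue B))) (f := fun D => f (D.image (Sum.elim π π)))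
  rw [hinter, prod_image hinl.injOn, prod_image hinl.injOn, prod_image hgl.injOn] at h
  simp only [image_image, sumElim_glue, Sum.elim_comp_inl] at h
  rw [sq]
  exact h

lemma exists_ssubsets_image_eq {W V : Type*} [DecidableEq W] [DecidableEq V] {g : W → V}
    {D : Finset W} {D' : Finset V} (hD' : D' ∈ (D.image g).ssubsets) :
    ∃ D'' ∈ D.ssubsets, D''.image g = D' := by
  rw [mem_ssubsets] at hD'
  obtain ⟨D'', hD'', rfl⟩ := subset_image_iff.1 hD'.1
  refine ⟨D'', ?_, rfl⟩
  rw [mem_ssubsets]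
  exact ⟨by exact_mod_cast hD'', fun h => hD'.2 (image_subset_image h)⟩

section doubleAlong

variable {W : Type*} [Fintype W] [DecidableEq W] {π : W → Fin r} {B : Finset W}
  {K : Finset (Finset W)}

lemma ssubsets_subset_doubleAlong (hK : ∀ B' ∈ K, B'.ssubsets ⊆ K) :
    ∀ D ∈ doubleAlong B K, D.ssubsets ⊆ doubleAlong B K := by
  intro D hD D' hD'
  rw [doubleAlong, mem_union, mem_image, mem_image] at *
  rcases hD with ⟨B', hB', rfl⟩ | ⟨B', hB', rfl⟩
  · obtain ⟨D'', hD'', rfl⟩ := exists_ssubsets_image_eq hD'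
    exact Or.inl ⟨D'', hK B' hB' hD'', rfl⟩
  · obtain ⟨D'', hD'', rfl⟩ := exists_ssubsets_image_eq hD'
    exact Or.inr ⟨D'', hK B' hB' hD'', rfl⟩

lemma injOn_of_mem_doubleAlong (hK : ∀ B' ∈ K, Set.InjOn π ↑B') {D : Finset (W ⊕ W)}
    (hD : D ∈ doubleAlong B K) : Set.InjOn (Sum.elim π π) ↑D := by
  rw [doubleAlong, mem_union, mem_image, mem_image] at hD
  rcases hD with ⟨B', hB', rfl⟩ | ⟨B', hB', rfl⟩
  · rw [coe_image]
    exact (show Set.InjOn (Sum.elim π π ∘ Sum.inl) _ from hK B' hB').image_of_comp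
  · rw [coe_image]
    refine Set.InjOn.image_of_comp ?_
    rw [sumElim_glue]
    exact hK B' hB'

lemma card_le_of_mem_doubleAlong {j : ℕ} (hK : ∀ B' ∈ K, #B' ≤ j) {D : Finset (W ⊕ W)}
    (hD : D ∈ doubleAlong B K) : #D ≤ j := by
  rw [doubleAlong, mem_union, mem_image, mem_image] at hD
  rcases hD with ⟨B', hB', rfl⟩ | ⟨B', hB', rfl⟩ <;> exact card_image_le.trans (hK B' hB')

end doubleAlong

lemma expect_deviation_mul_le_of_copies_le {L : ℕ} {c ξ τ θ : ℕ → ℝ} (hp : Compatible L c ξ τ θ)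
    (hx₀ : x₀ ∈ points px) {W : Type*} [Fintype W] [DecidableEq W] {π : W → Fin r} {B : Finset W}
    (hB : Set.InjOn π ↑B)
    (hreg : ∀ C : Finset (Fin r), #C ≤ #B → RegularAt px Q x₀ C (c #C) (τ #C) (θ #C))
    {K : Finset (Finset W)} (hK : B.ssubsets ⊆ K) (hcard : ∀ B' ∈ K, #B' < #B) (hKL : #K ≤ L)
    (h1 : copies px Q x₀ id (B.image π).ssubsets ≤
      2 ^ L * ∏ D ∈ (B.image π).ssubsets, faceDensity px Q x₀ D)
    (h2 : copies px Q x₀ (Sum.elim π π) (doubleAlong B K) ≤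
      2 ^ L * ∏ D ∈ doubleAlong B K, faceDensity px Q x₀ (D.image (Sum.elim π π)))
    {κ : Type*} (T : Finset κ) (S : κ → Finset W) (φ : κ → (W → X) → ℝ)
    (hφ : ∀ b ∈ T, ∀ y, |φ b y| ≤ 1) (hdep : ∀ b ∈ T, DependsOn (φ b) (S b : Set W))
    (hS : ∀ b ∈ T, ¬ B ⊆ S b)
    (hT : ∀ y, |∏ b ∈ T, φ b y| ≤ ∏ B' ∈ K, agree Q x₀ π B' y) :
    𝔼 y ∈ partiteMaps π px, (agree Q x₀ π B y - faceDensity px Q x₀ (B.image π)) *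
        ∏ b ∈ T, φ b y ≤
      2 * ξ #B * ∏ B' ∈ K, faceDensity px Q x₀ (B'.image π) := by
  set δ := faceDensity px Q x₀ with hδ
  have hcB : #(B.image π) = #B := card_image_of_injOn hB
  obtain ⟨-, e, u, hu, he, hdec⟩ := hreg (B.image π) hcB.le
  rw [hcB] at hu he
  have hδ0 : ∀ D, 0 ≤ δ D := fun D => faceDensity_nonneg D
  have hKδ : 0 ≤ ∏ B' ∈ K, δ (B'.image π) := prod_nonneg fun _ _ => hδ0 _
  have hprod := prod_doubleAlong_mul (π := π) δ hK hcard
  rw [prod_ssubsets_image hB] at h1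
  have hP1 : 0 ≤ ∏ B' ∈ B.ssubsets, δ (B'.image π) := prod_nonneg fun _ _ => hδ0 _
  have hP2 : 0 ≤ ∏ D ∈ doubleAlong B K, δ (D.image (Sum.elim π π)) :=
    prod_nonneg fun _ _ => hδ0 _
  have hR : τ #B * copies px Q x₀ id (B.image π).ssubsets *
      copies px Q x₀ (Sum.elim π π) (doubleAlong B K) ≤
        (ξ #B * ∏ B' ∈ K, δ (B'.image π)) ^ 2 := by
    calc τ #B * copies px Q x₀ id (B.image π).ssubsets *
          copies px Q x₀ (Sum.elim π π) (doubleAlong B K)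
        ≤ τ #B * (2 ^ L * ∏ B' ∈ B.ssubsets, δ (B'.image π)) *
          (2 ^ L * ∏ D ∈ doubleAlong B K, δ (D.image (Sum.elim π π))) := by
          have := hp.sq_nonneg #B
          have := copies_nonneg (px := px) (Q := Q) (x₀ := x₀) (π := Sum.elim π π)
            (doubleAlong B K)
          gcongr
      _ = (τ #B * (2 ^ L * 2 ^ L)) * (∏ B' ∈ K, δ (B'.image π)) ^ 2 := by
          rw [← hprod]; ring
      _ ≤ ξ #B ^ 2 * (∏ B' ∈ K, δ (B'.image π)) ^ 2 := by
          gcongr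
          exact hp.sq_le _
      _ = _ := by ring
  have hθ : θ #B ≤ ξ #B * ∏ B' ∈ K, δ (B'.image π) := by
    refine (hp.cut_le _).trans (mul_le_mul_of_nonneg_left ?_ (hp.err_pos _).le)
    refine pow_le_prod_of_le (hp.pos 0).le (hp.le_one 0) (fun B' hB' => ?_) hKL
    exact (hp.mono (Nat.zero_le _)).trans
      (hreg _ (card_image_le.trans (hcard B' hB').le)).1
  have := expect_deviation_mul_le ⟨x₀, hx₀⟩ hB hu he hdec hK T S φ hφ hdep hS hT
    (mul_nonneg (hp.err_pos _).le hKδ) hR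
  linarith

/-- Upper bound for the number of copies of a small chain in a regular chain. -/
theorem copies_le {N k : ℕ} {c ξ τ θ : ℕ → ℝ} (hp : Compatible (2 ^ N) c ξ τ θ)
    (hN : r * 2 ^ k ≤ N) (hx₀ : x₀ ∈ points px) :
    ∀ j ≤ k, (∀ C : Finset (Fin r), #C ≤ j → RegularAt px Q x₀ C (c #C) (τ #C) (θ #C)) →
    ∀ (W : Type) [Fintype W] [DecidableEq W] (π : W → Fin r) (K : Finset (Finset W)),
      Fintype.card W * 2 ^ j ≤ N → (∀ B ∈ K, B.ssubsets ⊆ K) →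
      (∀ B ∈ K, Set.InjOn π ↑B) → (∀ B ∈ K, #B ≤ j) →
      copies px Q x₀ π K ≤ 2 ^ #K * ∏ B ∈ K, faceDensity px Q x₀ (B.image π) := by
  have hcardle : ∀ {W : Type} [Fintype W] [DecidableEq W] {j : ℕ} (K : Finset (Finset W)),
      Fintype.card W * 2 ^ j ≤ N → #K ≤ 2 ^ N := by
    intro W _ _ j K hW
    refine (card_le_univ K).trans ?_
    rw [Fintype.card_finset]
    exact Nat.pow_le_pow_right two_pos
      ((Nat.le_mul_of_pos_right _ (by positivity)).trans hW)
  have hpow : ∀ {n : ℕ}, n ≤ 2 ^ N → (2 : ℝ) ^ n ≤ 2 ^ 2 ^ N := fun h =>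
    pow_le_pow_right₀ one_le_two h
  intro j
  induction j with
  | zero =>
    intro _ _ W _ _ π K _ _ _ hcard
    have h1 : copies px Q x₀ π K ≤ 1 := by
      rcases (partiteMaps π px).eq_empty_or_nonempty with h | h
      · simp [copies, h]
      · exact expect_le h fun y _ => prod_agree_le_one K y
    have h2 : ∏ B ∈ K, faceDensity px Q x₀ (B.image π) = 1 := by
      refine prod_eq_one fun B hB => ?_
      rw [card_eq_zero.1 (Nat.le_zero.1 (hcard B hB)), image_empty, faceDensity_empty hx₀]
    rw [h2, mul_one]
    exact h1.trans (one_le_pow₀ one_le_two)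
  | succ j ih =>
    intro hjk hreg W _ _ π K hW hdown hinj hcard
    have ih' := ih (by omega) (fun C hC => hreg C (by omega))
    set δ := faceDensity px Q x₀ with hδ
    have hδ0 : ∀ D, 0 ≤ δ D := fun D => faceDensity_nonneg D
    set K₀ := K.filter fun B => #B ≤ j with hK₀
    have hlow : ∀ B ∈ K, ∀ B' ∈ B.ssubsets, B' ∈ K₀ := by
      intro B hB B' hB'
      have := card_lt_card (mem_ssubsets.1 hB')
      exact mem_filter.2 ⟨hdown B hB hB', by have := hcard B hB; omega⟩
    have hW' : Fintype.card (W ⊕ W) * 2 ^ j ≤ N := by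
      rw [Fintype.card_sum]; rw [pow_succ] at hW; linarith
    have hWj : Fintype.card W * 2 ^ j ≤ N :=
      le_trans (Nat.mul_le_mul_left _ (Nat.pow_le_pow_right two_pos (Nat.le_succ j))) hW
    have key : ∀ T : Finset (Finset W), T ⊆ K.filter (fun B => #B = j + 1) →
        copies px Q x₀ π (T ∪ K₀) ≤ 2 ^ #(T ∪ K₀) * ∏ B ∈ T ∪ K₀, δ (B.image π) := by
      intro T
      induction T using Finset.induction_on with
      | empty =>
        intro _
        rw [empty_union]
        refine ih' W π K₀ hWj (fun B hB B' hB' => hlow B (mem_filter.1 hB).1 B' hB')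
          (fun B hB => hinj B (mem_filter.1 hB).1) fun B hB => (mem_filter.1 hB).2
      | insert B T hBT ihT =>
        intro hT
        have hT' := ihT ((subset_insert _ _).trans hT)
        obtain ⟨hBK, hBc⟩ := mem_filter.1 (hT (mem_insert_self B T))
        have hBK₀ : B ∉ K₀ := fun h => by have := (mem_filter.1 h).2; omega
        have hBU : B ∉ T ∪ K₀ := by simp [hBT, hBK₀]
        have herr := expect_deviation_mul_le_of_copies_le hp hx₀ (hinj B hBK) (K := K₀)
          (fun C hC => hreg C (by omega)) (hlow B hBK)
          (fun B' hB' => by have := (mem_filter.1 hB').2; omega) (hcardle K₀ hWj) ?_ ?_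
          (T ∪ K₀) id (fun B' => agree Q x₀ π B') (fun _ _ y => abs_agree_le_one _ y)
          (fun B' _ => dependsOn_agree B') ?_ ?_
        · rw [insert_union, copies, card_insert_of_notMem hBU, prod_insert hBU]
          have hsplit : 𝔼 y ∈ partiteMaps π px, ∏ B' ∈ insert B (T ∪ K₀), agree Q x₀ π B' y =
              δ (B.image π) * copies px Q x₀ π (T ∪ K₀) +
              𝔼 y ∈ partiteMaps π px, (agree Q x₀ π B y - δ (B.image π)) *
                ∏ B' ∈ T ∪ K₀, agree Q x₀ π B' y := by
            rw [copies, mul_expect, ← expect_add_distrib]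
            refine expect_congr rfl fun y _ => ?_
            rw [prod_insert hBU]; ring
          rw [hsplit]
          have hsmall : 2 * ξ #B * ∏ B' ∈ K₀, δ (B'.image π) ≤
              δ (B.image π) * ∏ B' ∈ T ∪ K₀, δ (B'.image π) := by
            rw [← prod_insert (f := fun B' => δ (B'.image π)) hBU, ← insert_union,
              prod_union]
            · refine mul_le_mul_of_nonneg_right ?_ (prod_nonneg fun _ _ => hδ0 _)
              refine (hp.err_le _).trans (pow_le_prod_of_le (hp.pos _).le (hp.le_one _)
                (fun B' hB' => ?_) (hcardle (insert B T) hWj))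
              obtain ⟨hB'K, hB'c⟩ := mem_filter.1 (hT hB')
              have hc : #(B'.image π) = #B := by
                rw [card_image_of_injOn (hinj B' hB'K), hB'c, hBc]
              have := (hreg (B'.image π) (by omega)).1
              rwa [hc] at this
            · rw [disjoint_left]
              intro B' h h'
              have := (mem_filter.1 (hT h)).2
              have := (mem_filter.1 h').2
              omega
          have hnn : 0 ≤ δ (B.image π) * ∏ B' ∈ T ∪ K₀, δ (B'.image π) :=
            mul_nonneg (hδ0 _) (prod_nonneg fun _ _ => hδ0 _)
          have hone : (1 : ℝ) ≤ 2 ^ #(T ∪ K₀) := one_le_pow₀ one_le_two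
          have hmul := mul_le_mul_of_nonneg_left hT' (hδ0 (B.image π))
          have herr' := herr.trans hsmall
          rw [pow_succ]
          nlinarith [mul_le_mul_of_nonneg_right hone hnn]
        · have h := ih' (Fin r) id (B.image π).ssubsets ?_ ?_ (fun _ _ => Set.injOn_id _) ?_
          · refine h.trans ?_
            simp only [image_id]
            refine mul_le_mul_of_nonneg_right (hpow (hcardle (j := k) _ ?_))
              (prod_nonneg fun _ _ => hδ0 _)
            rwa [Fintype.card_fin]
          · rw [Fintype.card_fin]
            exact (Nat.mul_le_mul_left _ (Nat.pow_le_pow_right two_pos (by omega))).trans hN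
          · intro D hD D' hD'
            rw [mem_ssubsets] at *
            exact hD'.trans hD
          · intro D hD
            have := card_lt_card (mem_ssubsets.1 hD)
            have := card_image_le (s := B) (f := π)
            omega
        · have h := ih' (W ⊕ W) (Sum.elim π π) (doubleAlong B K₀) hW' ?_ ?_ ?_
          · refine h.trans (mul_le_mul_of_nonneg_right (hpow (hcardle _ hW'))
              (prod_nonneg fun _ _ => hδ0 _))
          · exact ssubsets_subset_doubleAlong fun B hB B' hB' => hlow B (mem_filter.1 hB).1 B' hB'
          · exact fun D => injOn_of_mem_doubleAlong fun B' hB' => hinj B' (mem_filter.1 hB').1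
          · exact fun D => card_le_of_mem_doubleAlong fun B' hB' => (mem_filter.1 hB').2
        · intro B' hB' hsub
          have hle : #B' ≤ #B := by
            rcases mem_union.1 hB' with h | h
            · have := (mem_filter.1 (hT (mem_insert_of_mem h))).2; omega
            · have := (mem_filter.1 h).2; omega
          exact hBU (eq_of_subset_of_card_le hsub hle ▸ hB')
        · intro y
          rw [abs_of_nonneg (prod_agree_nonneg _ y), prod_union]
          · exact mul_le_of_le_one_left (prod_agree_nonneg _ y) (prod_agree_le_one _ y)
          · rw [disjoint_left]
            intro B' h h'
            have := (mem_filter.1 (hT (mem_insert_of_mem h))).2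
            have := (mem_filter.1 h').2
            omega
    have hKU : K.filter (fun B => #B = j + 1) ∪ K₀ = K := by
      ext B
      simp only [hK₀, mem_union, mem_filter]
      constructor
      · rintro (h | h) <;> exact h.1
      · intro h
        have := hcard B h
        rcases Nat.lt_or_ge j #B with h' | h'
        · exact Or.inl ⟨h, by omega⟩
        · exact Or.inr ⟨h, h'⟩
    have := key _ subset_rfl
    rwa [hKU] at this

end Counting

section Octahedra

variable {X : Type*} [Fintype X] [DecidableEq X] {px : X → Fin r}
  {Q : Finset (Fin r) → Finset X → ℕ} {x₀ : Fin r → X} {k : ℕ}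

section Faces

variable {W : Type*} [Fintype W] [DecidableEq W] {π : W → Fin r} {B : Finset W} {y : W → X}

lemma agree_eq_one_iff : agree Q x₀ π B y = 1 ↔
    Q (B.image π) (B.image y) = Q (B.image π) ((B.image π).image x₀) := by
  unfold agree; split_ifs with h <;> simp [h]

lemma comp_of_mem_partiteMaps (hy : y ∈ partiteMaps π px) : px ∘ y = π :=
  funext fun w => mem_partiteMaps.1 hy w

lemma injOn_of_mem_partiteMaps (hy : y ∈ partiteMaps π px) (hB : Set.InjOn π ↑B) :
    Set.InjOn y ↑B := fun w hw w' hw' h =>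
  hB hw hw' (by rw [← mem_partiteMaps.1 hy, ← mem_partiteMaps.1 hy, h])

lemma injOn_image_of_mem_partiteMaps (hy : y ∈ partiteMaps π px) (hB : Set.InjOn π ↑B) :
    Set.InjOn px ↑(B.image y) := by
  rw [coe_image]
  refine Set.InjOn.image_of_comp ?_
  rwa [comp_of_mem_partiteMaps hy]

lemma image_image_of_mem_partiteMaps (hy : y ∈ partiteMaps π px) :
    (B.image y).image px = B.image π := by
  rw [image_image, comp_of_mem_partiteMaps hy]

lemma filter_image_of_mem_partiteMaps (hy : y ∈ partiteMaps π px) (hB : Set.InjOn π ↑B)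
    {B' : Finset W} (hB' : B' ⊆ B) :
    ((B.image y).filter fun v => px v ∈ B'.image π) = B'.image y := by
  ext v
  simp only [mem_filter, mem_image]
  constructor
  · rintro ⟨⟨w, hw, rfl⟩, w', hw', h⟩
    rw [mem_partiteMaps.1 hy] at h
    exact ⟨w', hw', by rw [hB (hB' hw') hw h]⟩
  · rintro ⟨w, hw, rfl⟩
    exact ⟨⟨w, hB' hw, rfl⟩, w, hw, (mem_partiteMaps.1 hy w).symm⟩

lemma image_mem_chainOf (hy : y ∈ partiteMaps π px) (hB : Set.InjOn π ↑B) (hk : #B ≤ k) :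
    B.image y ∈ chainOf px k Q x₀ ↔ ∀ B' ⊆ B, agree Q x₀ π B' y = 1 := by
  simp only [chainOf, mem_filter, mem_univ, true_and, agree_eq_one_iff]
  constructor
  · rintro ⟨-, -, h⟩ B' hB'
    have := h (B'.image π) (by
      rw [image_image_of_mem_partiteMaps hy]; exact image_subset_image hB')
    rwa [filter_image_of_mem_partiteMaps hy hB hB'] at this
  · intro h
    refine ⟨injOn_image_of_mem_partiteMaps hy hB, card_image_le.trans hk, fun C hC => ?_⟩
    rw [image_image_of_mem_partiteMaps hy] at hC
    obtain ⟨B', hB', rfl⟩ := subset_image_iff.1 hC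
    have hB' : B' ⊆ B := by exact_mod_cast hB'
    rw [filter_image_of_mem_partiteMaps hy hB hB']
    exact h B' hB'

lemma image_mem_hstar (hy : y ∈ partiteMaps π px) (hB : Set.InjOn π ↑B) (hk : #B ≤ k) :
    B.image y ∈ hstar px (chainOf px k Q x₀) (B.image π) ↔
      ∀ B' ∈ B.ssubsets, agree Q x₀ π B' y = 1 := by
  have hsub : ∀ B' ⊆ B, (B'.image y ∈ chainOf px k Q x₀ ↔
      ∀ B'' ⊆ B', agree Q x₀ π B'' y = 1) := fun B' hB' =>
    image_mem_chainOf hy (hB.mono (by exact_mod_cast hB')) ((card_le_card hB').trans hk)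
  simp only [hstar, mem_filter, mem_univ, true_and]
  constructor
  · rintro ⟨-, -, h⟩ B' hB'
    rw [mem_ssubsets] at hB'
    refine (hsub B' hB'.1).1 (h _ ?_) B' subset_rfl
    refine (image_subset_image hB'.1).ssubset_of_ne fun heq => hB'.2 fun w hw => ?_
    obtain ⟨w', hw', h'⟩ := mem_image.1 (heq ▸ mem_image_of_mem y hw)
    rwa [← injOn_of_mem_partiteMaps hy hB (hB'.1 hw') hw h']
  · intro h
    refine ⟨injOn_image_of_mem_partiteMaps hy hB, image_image_of_mem_partiteMaps hy,
      fun C hC => ?_⟩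
    obtain ⟨B', hB', rfl⟩ := exists_ssubsets_image_eq (mem_ssubsets.2 hC)
    rw [mem_ssubsets] at hB'
    exact (hsub B' hB'.1).2 fun B'' hB'' => h _ (mem_ssubsets.2 (hB''.trans_ssubset hB'))

lemma prod_agree_eq_one_iff {K : Finset (Finset W)} :
    ∏ B ∈ K, agree Q x₀ π B y = 1 ↔ ∀ B ∈ K, agree Q x₀ π B y = 1 := by
  constructor
  · intro h B hB
    rcases agree_eq_zero_or_one (Q := Q) (x₀ := x₀) (π := π) B y with h0 | h1
    · rw [prod_eq_zero hB h0] at h; exact absurd h zero_ne_one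
    · exact h1
  · exact fun h => prod_eq_one h

lemma devFun_image (hy : y ∈ partiteMaps π px) (hB : Set.InjOn π ↑B) (hk : #B ≤ k) :
    devFun px (chainOf px k Q x₀) (B.image π) (B.image y) =
      (agree Q x₀ π B y - relDensity px (chainOf px k Q x₀) (B.image π)) *
        ∏ B' ∈ B.ssubsets, agree Q x₀ π B' y := by
  unfold devFun
  have hst := image_mem_hstar (Q := Q) (x₀ := x₀) hy hB hk
  have hch := image_mem_chainOf (Q := Q) (x₀ := x₀) hy hB hk
  rw [← prod_agree_eq_one_iff] at hst
  rcases prod_agree_eq_zero_or_one (Q := Q) (x₀ := x₀) (π := π) B.ssubsets y with h | h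
  · rw [if_neg (by rw [hst, h]; exact zero_ne_one), h, mul_zero]
  · have h' := prod_agree_eq_one_iff.1 h
    rw [if_pos (hst.2 h), h, mul_one]
    congr 1
    rcases agree_eq_zero_or_one (Q := Q) (x₀ := x₀) (π := π) B y with h0 | h1
    · rw [h0, if_neg]
      exact fun hall => by simpa [h0] using hch.1 hall B subset_rfl
    · rw [h1, if_pos]
      refine hch.2 fun B' hB' => ?_
      rcases eq_or_ne B' B with rfl | hne
      · exact h1
      · exact h' B' (mem_ssubsets.2 (hB'.ssubset_of_ne hne))

end Faces

lemma exists_image_eq_of_mem_completeK (hx₀ : x₀ ∈ points px) {S : Finset (Fin r)}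
    {F : Finset X} (hF : F ∈ completeK px S) : ∃ x ∈ points px, S.image x = F := by
  simp only [completeK, mem_filter, mem_univ, true_and] at hF
  obtain ⟨hinj, rfl⟩ := hF
  have hch : ∀ i, ∃ v, px v = i ∧ (i ∈ F.image px → v ∈ F) := by
    intro i
    by_cases hi : i ∈ F.image px
    · obtain ⟨v, hv, rfl⟩ := mem_image.1 hi
      exact ⟨v, rfl, fun _ => hv⟩
    · exact ⟨x₀ i, mem_partiteMaps.1 hx₀ i, fun h => absurd h hi⟩
  choose x hx hxF using hch
  refine ⟨x, mem_partiteMaps.2 hx, ?_⟩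
  ext v
  constructor
  · intro hv
    obtain ⟨i, hi, rfl⟩ := mem_image.1 hv
    exact hxF i hi
  · intro hv
    refine mem_image.2 ⟨px v, mem_image_of_mem _ hv, ?_⟩
    exact hinj (hxF _ (mem_image_of_mem _ hv)) hv (hx _)

/-- All fibres of the map from points to partite sets of index `S` have the same size. -/
lemma card_filter_image_mem (hx₀ : x₀ ∈ points px) {S : Finset (Fin r)}
    {A : Finset (Finset X)} (hA : A ⊆ completeK px S) :
    #{x ∈ points px | S.image x ∈ A} = #{x ∈ points px | S.image x = S.image x₀} * #A := by
  have hconst : ∀ F ∈ A, #{x ∈ points px | S.image x = F} =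
      #{x ∈ points px | S.image x = S.image x₀} := by
    intro F hF
    obtain ⟨x₁, hx₁, rfl⟩ := exists_image_eq_of_mem_completeK hx₀ (hA hF)
    have key : ∀ {a b x : Fin r → X}, a ∈ points px → b ∈ points px → x ∈ points px →
        S.image x = S.image a → splice id S a (splice id S b x) = x := by
      intro a b x ha hb hx h
      funext i
      by_cases hi : i ∈ S
      · simp only [splice, if_pos hi]
        exact (image_inj_of_mem_points hx ha h i hi).symm
      · simp [splice, hi]
    have him : ∀ a x : Fin r → X, S.image (splice id S a x) = S.image a := by
      intro a x
      rw [image_splice subset_rfl, image_id]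
    refine card_nbij' (splice id S x₀) (splice id S x₁) ?_ ?_ ?_ ?_
    · intro x hx
      simp only [coe_filter, Set.mem_ofPred_eq] at hx ⊢
      exact ⟨splice_mem hx₀ hx.1, him _ _⟩
    · intro x hx
      simp only [coe_filter, Set.mem_ofPred_eq] at hx ⊢
      exact ⟨splice_mem hx₁ hx.1, him _ _⟩
    · intro x hx
      simp only [coe_filter, Set.mem_ofPred_eq] at hx
      exact key hx₁ hx₀ hx.1 hx.2
    · intro x hx
      simp only [coe_filter, Set.mem_ofPred_eq] at hx
      exact key hx₀ hx₁ hx.1 hx.2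
  rw [card_eq_sum_card_fiberwise (f := fun x : Fin r → X => S.image x) (t := A)
    (fun x hx => by simpa using (mem_filter.1 hx).2)]
  rw [mul_comm, ← smul_eq_mul, ← sum_const]
  refine sum_congr rfl fun F hF => ?_
  rw [← hconst F hF, filter_filter]
  congr 1
  ext x
  simp only [mem_filter, and_congr_right_iff, and_iff_right_iff_imp]
  rintro - rfl
  exact hF

lemma copies_eq_card_div {K : Finset (Finset (Fin r))} :
    copies px Q x₀ id K =
      (#{x ∈ points px | ∀ D ∈ K, agree Q x₀ id D x = 1} : ℝ) / #(points px) := by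
  rw [copies, expect_eq_sum_div_card, ← sum_boole]
  congr 1
  refine sum_congr rfl fun x _ => ?_
  have hiff := prod_agree_eq_one_iff (Q := Q) (x₀ := x₀) (π := id) (K := K) (y := x)
  rcases prod_agree_eq_zero_or_one (Q := Q) (x₀ := x₀) (π := id) K x with h | h
  · rw [h, if_neg (by rw [← hiff, h]; exact zero_ne_one)]
  · rw [h, if_pos (hiff.1 h)]

lemma relDensity_chainOf (hx₀ : x₀ ∈ points px) {S : Finset (Fin r)} (hS : #S ≤ k) :
    relDensity px (chainOf px k Q x₀) S = faceDensity px Q x₀ S := by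
  have hn : (#(points px) : ℝ) ≠ 0 := by
    have : 0 < #(points px) := card_pos.2 ⟨x₀, hx₀⟩
    positivity
  have hf : (#{x ∈ points px | S.image x = S.image x₀} : ℝ) ≠ 0 := by
    have : 0 < #{x ∈ points px | S.image x = S.image x₀} := card_pos.2 ⟨x₀, by simp [hx₀]⟩
    positivity
  have h1 := card_filter_image_mem hx₀ (S := S)
    (A := (chainOf px k Q x₀).filter fun F => F.image px = S) (by
      intro F hF
      simp only [chainOf, completeK, mem_filter, mem_univ, true_and] at hF ⊢
      exact ⟨hF.1.1, hF.2⟩)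
  have h2 := card_filter_image_mem hx₀ (S := S) (A := hstar px (chainOf px k Q x₀) S) (by
      intro F hF
      simp only [hstar, completeK, mem_filter, mem_univ, true_and] at hF ⊢
      exact ⟨hF.1, hF.2.1⟩)
  have h1' : {x ∈ points px | S.image x ∈ (chainOf px k Q x₀).filter fun F => F.image px = S} =
      {x ∈ points px | ∀ D ∈ S.powerset, agree Q x₀ id D x = 1} := by
    refine filter_congr fun x hx => ?_
    have h := image_image_of_mem_partiteMaps (B := S) hx
    rw [image_id] at h
    rw [mem_filter, image_mem_chainOf hx (Set.injOn_id _) hS]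
    simp [h]
  have h2' : {x ∈ points px | S.image x ∈ hstar px (chainOf px k Q x₀) S} =
      {x ∈ points px | ∀ D ∈ S.ssubsets, agree Q x₀ id D x = 1} := by
    refine filter_congr fun x hx => ?_
    have h := image_mem_hstar (Q := Q) (x₀ := x₀) (B := S) hx (Set.injOn_id _) hS
    rwa [image_id] at h
  rw [faceDensity, copies_eq_card_div, copies_eq_card_div, ← h1', ← h2', h1, h2,
    div_div_div_cancel_right₀ hn]
  push_cast
  rw [mul_div_mul_left _ _ hf]
  rfl

lemma octNorm_chainOf (hx₀ : x₀ ∈ points px) {S : Finset (Fin r)} (hS : #S ≤ k) :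
    octNorm px (chainOf px k Q x₀) S = ∏ C ∈ S.powerset, faceDensity px Q x₀ C ^ 2 ^ #C :=
  prod_congr rfl fun C hC => by
    rw [relDensity_chainOf hx₀ ((card_le_card (mem_powerset.1 hC)).trans hS)]

/-- The part of each vertex of the octahedron of index `S`. -/
def octPart (S : Finset (Fin r)) : {i // i ∈ S} ⊕ {i // i ∈ S} → Fin r :=
  Sum.elim Subtype.val Subtype.val

/-- The face of the octahedron of index `S` determined by `T ⊆ S`. -/
noncomputable def octFace (S T : Finset (Fin r)) : Finset ({i // i ∈ S} ⊕ {i // i ∈ S}) :=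
  S.attach.image fun i : {i // i ∈ S} => if (i : Fin r) ∈ T then Sum.inr i else Sum.inl i

lemma octPart_ite {S T : Finset (Fin r)} (i : {i // i ∈ S}) :
    octPart S (if (i : Fin r) ∈ T then Sum.inr i else Sum.inl i) = i := by
  split_ifs <;> rfl

lemma octFace_image {S T : Finset (Fin r)} : (octFace S T).image (octPart S) = S := by
  rw [octFace, image_image]
  simp only [Function.comp_def, octPart_ite, attach_image_val]

lemma injOn_octFace {S T : Finset (Fin r)} : Set.InjOn (octPart S) ↑(octFace S T) := by
  rw [octFace, coe_image]
  refine Set.InjOn.image_of_comp ?_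
  simp only [Function.comp_def, octPart_ite]
  exact Subtype.val_injective.injOn

lemma card_octFace {S T : Finset (Fin r)} : #(octFace S T) = #S := by
  rw [← card_image_of_injOn (injOn_octFace (S := S) (T := T)), octFace_image]

lemma octFace_inj {S T T' : Finset (Fin r)} (hT : T ⊆ S) (hT' : T' ⊆ S)
    (h : octFace S T ⊆ octFace S T') : T = T' := by
  have key : ∀ i ∈ S, (i ∈ T ↔ i ∈ T') := by
    intro i hi
    have h1 : (if i ∈ T then Sum.inr ⟨i, hi⟩ else Sum.inl ⟨i, hi⟩) ∈ octFace S T :=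
      mem_image.2 ⟨⟨i, hi⟩, mem_attach _ _, rfl⟩
    obtain ⟨j, -, hj⟩ := mem_image.1 (h h1)
    have hij : (j : Fin r) = i := by
      have := congrArg (octPart S) hj
      rw [octPart_ite] at this
      rw [this]
      exact octPart_ite (S := S) (T := T) ⟨i, hi⟩
    rw [hij] at hj
    split_ifs at hj <;> tauto
  ext i
  exact ⟨fun hi => (key i (hT hi)).1 hi, fun hi => (key i (hT' hi)).2 hi⟩

lemma oct_eq_expect (S : Finset (Fin r)) (g : Finset X → ℝ) :
    oct px S g = 𝔼 y ∈ partiteMaps (octPart S) px,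
      ∏ T ∈ S.powerset, g ((octFace S T).image y) := by
  have hcard : ((#(partiteMaps (octPart S) px) : ℕ) : ℝ) =
      ∏ i ∈ S, ((univ.filter fun x : X => px x = i).card : ℝ) ^ 2 := by
    have h : partiteMaps (octPart S) px =
        Fintype.piFinset fun w => univ.filter fun x : X => px x = octPart S w := by
      ext y; simp [mem_partiteMaps]
    rw [h, Fintype.card_piFinset, Fintype.prod_sum_type]
    simp only [octPart, Sum.elim_inl, Sum.elim_inr]
    push_cast
    rw [← prod_coe_sort S fun i => ((univ.filter fun x : X => px x = i).card : ℝ) ^ 2,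
      ← prod_mul_distrib]
    exact prod_congr rfl fun i _ => (sq _).symm
  rw [oct, expect_eq_sum_div_card, hcard]
  congr 1
  rw [← sum_product', ← sum_filter]
  refine sum_nbij' (fun p => Sum.elim p.1 p.2) (fun y => (y ∘ Sum.inl, y ∘ Sum.inr))
    ?_ ?_ ?_ ?_ ?_
  · rintro ⟨x0, x1⟩ h
    have h := (mem_filter.1 h).2
    rw [mem_partiteMaps]
    rintro (i | i)
    exacts [(h i).1, (h i).2]
  · intro y hy
    rw [mem_partiteMaps] at hy
    simp only [univ_product_univ, mem_filter, mem_univ, true_and]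
    exact fun i => ⟨hy (Sum.inl i), hy (Sum.inr i)⟩
  · rintro ⟨x0, x1⟩ -
    simp
  · intro y _
    exact Sum.elim_comp_inl_inr y
  · rintro ⟨x0, x1⟩ -
    refine prod_congr rfl fun T _ => ?_
    rw [octFace, image_image]
    congr 2
    funext i
    simp only [Function.comp]
    split_ifs <;> rfl

/-- The edges of size less than `|S|` of the octahedron of index `S`. -/
noncomputable def octBoundary (S : Finset (Fin r)) : Finset (Finset ({i // i ∈ S} ⊕ {i // i ∈ S})) :=
  S.powerset.biUnion fun T => (octFace S T).ssubsets

lemma mem_octBoundary {S : Finset (Fin r)} {B : Finset ({i // i ∈ S} ⊕ {i // i ∈ S})} :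
    B ∈ octBoundary S ↔ ∃ T ⊆ S, B ⊂ octFace S T := by
  simp [octBoundary]

lemma le_card_filter_octBoundary {S C : Finset (Fin r)} (hC : C ∈ S.ssubsets) :
    2 ^ #C ≤ #{B ∈ octBoundary S | B.image (octPart S) = C} := by
  rw [mem_ssubsets] at hC
  let G : Finset (Fin r) → Finset ({i // i ∈ S} ⊕ {i // i ∈ S}) := fun T =>
    (octFace S T).filter fun w => octPart S w ∈ C
  have hG : ∀ T, (G T).image (octPart S) = C := by
    intro T
    ext i
    simp only [G, mem_image, mem_filter]
    constructor
    · rintro ⟨w, ⟨-, hw⟩, rfl⟩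
      exact hw
    · intro hi
      have : i ∈ (octFace S T).image (octPart S) := by rw [octFace_image]; exact hC.1 hi
      obtain ⟨w, hw, rfl⟩ := mem_image.1 this
      exact ⟨w, ⟨hw, hi⟩, rfl⟩
  rw [← card_powerset]
  refine card_le_card_of_injOn G ?_ ?_
  · intro T hT
    rw [mem_coe, mem_powerset] at hT
    rw [mem_coe, mem_filter, mem_octBoundary]
    refine ⟨⟨T, hT.trans hC.1, (filter_subset _ _).ssubset_of_ne fun h => hC.ne ?_⟩, hG T⟩
    rw [← hG T, show G T = octFace S T from h, octFace_image]
  · intro T hT T' hT' h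
    rw [mem_coe, mem_powerset] at hT hT'
    have key : ∀ {T T' : Finset (Fin r)}, T ⊆ C → G T = G T' → T ⊆ T' := by
      intro T T' hT h i hi
      have h1 : (Sum.inr ⟨i, hC.1 (hT hi)⟩ : {i // i ∈ S} ⊕ {i // i ∈ S}) ∈ G T := by
        refine mem_filter.2 ⟨mem_image.2 ⟨⟨i, hC.1 (hT hi)⟩, mem_attach _ _, ?_⟩, hT hi⟩
        simp [hi]
      rw [h] at h1
      obtain ⟨j, -, hj⟩ := mem_image.1 (mem_filter.1 h1).1
      split_ifs at hj with hjT
      rw [Sum.inr_injective hj] at hjT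
      exact hjT
    exact (key hT h).antisymm (key hT' h.symm)

/-- In a regular chain every face indicator is quasirandom. -/
theorem oct_devFun_le {N : ℕ} {c ξ τ θ : ℕ → ℝ} (hp : Compatible (2 ^ N) c ξ τ θ)
    (hN : r * 2 ^ k * 2 ≤ N) (hx₀ : x₀ ∈ points px) {S : Finset (Fin r)} (hS : #S ≤ k)
    (hreg : ∀ C : Finset (Fin r), #C ≤ #S → RegularAt px Q x₀ C (c #C) (τ #C) (θ #C)) :
    oct px S (devFun px (chainOf px k Q x₀) S) ≤
      2 * ξ #S * ∏ C ∈ S.ssubsets, faceDensity px Q x₀ C ^ 2 ^ #C := by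
  set δ := faceDensity px Q x₀ with hδ
  have hδ0 : ∀ D, 0 ≤ δ D := fun D => faceDensity_nonneg D
  have hδ1 : ∀ D, δ D ≤ 1 := fun D => faceDensity_le_one D
  set π := octPart S with hπ
  set K := octBoundary S with hKdef
  have hBcard : ∀ T, #(octFace S T) = #S := fun T => card_octFace
  have hKcard : ∀ B' ∈ K, #B' < #S := by
    intro B' hB'
    obtain ⟨T, -, h⟩ := mem_octBoundary.1 hB'
    exact (card_lt_card h).trans_eq (hBcard T)
  have hKdown : ∀ B' ∈ K, B'.ssubsets ⊆ K := by
    intro B' hB' B'' hB''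
    obtain ⟨T, hT, h⟩ := mem_octBoundary.1 hB'
    exact mem_octBoundary.2 ⟨T, hT, (mem_ssubsets.1 hB'').trans h⟩
  have hKinj : ∀ B' ∈ K, Set.InjOn π ↑B' := by
    intro B' hB'
    obtain ⟨T, -, h⟩ := mem_octBoundary.1 hB'
    exact injOn_octFace.mono (by exact_mod_cast h.1)
  have hrew : oct px S (devFun px (chainOf px k Q x₀) S) =
      𝔼 y ∈ partiteMaps π px, (agree Q x₀ π (octFace S ∅) y - δ ((octFace S ∅).image π)) *
        ∏ b ∈ K.disjSum (S.powerset.erase ∅), (Sum.elim (fun B' => agree Q x₀ π B')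
          (fun T y => agree Q x₀ π (octFace S T) y - δ S) : _ → _ → ℝ) b y := by
    rw [oct_eq_expect]
    refine expect_congr rfl fun y hy => ?_
    have h1 : ∀ T, devFun px (chainOf px k Q x₀) S ((octFace S T).image y) =
        (agree Q x₀ π (octFace S T) y - δ S) *
          ∏ B' ∈ (octFace S T).ssubsets, agree Q x₀ π B' y := by
      intro T
      have := devFun_image (Q := Q) (x₀ := x₀) hy (injOn_octFace (S := S) (T := T))
        (k := k) (by rw [hBcard]; exact hS)
      rw [octFace_image, relDensity_chainOf hx₀ hS] at this
      exact this
    simp only [h1, prod_mul_distrib]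
    rw [prod_disjSum, ← mul_prod_erase _ _ (empty_mem_powerset S)]
    simp only [Sum.elim_inl, Sum.elim_inr]
    have h2 : ∏ T ∈ S.powerset, ∏ B' ∈ (octFace S T).ssubsets, agree Q x₀ π B' y =
        ∏ B' ∈ K, agree Q x₀ π B' y := by
      rcases prod_agree_eq_zero_or_one (Q := Q) (x₀ := x₀) (π := π) K y with h | h
      · rw [h]
        obtain ⟨B', hB', h0⟩ := prod_eq_zero_iff.1 h
        obtain ⟨T, hT, hB'⟩ := mem_octBoundary.1 hB'
        exact prod_eq_zero (mem_powerset.2 hT) (prod_eq_zero (mem_ssubsets.2 hB') h0)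
      · rw [h]
        exact prod_eq_one fun T hT => prod_eq_one fun B' hB' => prod_agree_eq_one_iff.1 h B'
          (mem_octBoundary.2 ⟨T, mem_powerset.1 hT, mem_ssubsets.1 hB'⟩)
    rw [h2, hπ, octFace_image]
    ring
  rw [hrew]
  have hW : Fintype.card ({i // i ∈ S} ⊕ {i // i ∈ S}) = 2 * #S := by
    rw [Fintype.card_sum, Fintype.card_coe]; ring
  have hSr : #S ≤ r := by simpa using card_le_univ S
  have hpk : #S * 2 ^ #S ≤ r * 2 ^ k :=
    Nat.mul_le_mul hSr (Nat.pow_le_pow_right two_pos hS)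
  have hlevel : ∀ n, n ≤ 4 * #S → n * 2 ^ (#S - 1) ≤ N := by
    intro n hn
    rcases Nat.eq_zero_or_pos #S with h0 | hpos
    · rw [h0, mul_zero, Nat.le_zero] at hn
      rw [hn, zero_mul]; exact Nat.zero_le _
    · obtain ⟨m, hm⟩ : ∃ m, #S = m + 1 := ⟨#S - 1, by omega⟩
      rw [hm, pow_succ] at hpk
      rw [hm] at hn ⊢
      rw [Nat.add_sub_cancel]
      have := Nat.mul_le_mul_right (2 ^ m) hn
      nlinarith
  have hcardle : ∀ {V : Type} [Fintype V] [DecidableEq V] (K' : Finset (Finset V)),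
      Fintype.card V ≤ N → #K' ≤ 2 ^ N := by
    intro V _ _ K' hV
    refine (card_le_univ K').trans ?_
    rw [Fintype.card_finset]
    exact Nat.pow_le_pow_right two_pos hV
  have hrN : r ≤ N := by
    have : 1 ≤ 2 ^ k := Nat.one_le_two_pow
    nlinarith
  have h4 : 4 * #S ≤ N := by
    have := hlevel _ le_rfl
    exact (Nat.le_mul_of_pos_right _ (by positivity)).trans this
  have hpow : ∀ {n : ℕ}, n ≤ 2 ^ N → (2 : ℝ) ^ n ≤ 2 ^ 2 ^ N := fun h =>
    pow_le_pow_right₀ one_le_two h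
  have hcop := copies_le (k := k) hp (by omega : r * 2 ^ k ≤ N) hx₀ (#S - 1) (by omega)
    (fun C hC => hreg C (by omega))
  have herr := expect_deviation_mul_le_of_copies_le hp hx₀ (π := π) (B := octFace S ∅)
    injOn_octFace (fun C hC => hreg C (by rwa [hBcard] at hC)) (K := K)
    (fun B' hB' => mem_octBoundary.2 ⟨∅, empty_subset _, mem_ssubsets.1 hB'⟩)
    (fun B' hB' => by rw [hBcard]; exact hKcard B' hB') (hcardle K (by omega)) ?_ ?_
    (K.disjSum (S.powerset.erase ∅)) (Sum.elim id (octFace S))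
    (Sum.elim (fun B' => agree Q x₀ π B') (fun T y => agree Q x₀ π (octFace S T) y - δ S))
    ?_ ?_ ?_ ?_
  · refine herr.trans ?_
    rw [hBcard]
    refine mul_le_mul_of_nonneg_left ?_ (mul_nonneg zero_le_two (hp.err_pos _).le)
    rw [← prod_fiberwise_of_maps_to (g := fun B' => B'.image π) (t := S.ssubsets)]
    · refine prod_le_prod (fun C _ => prod_nonneg fun _ _ => hδ0 _) fun C hC => ?_
      rw [prod_congr rfl (g := fun _ => δ C) fun B' hB' => by rw [(mem_filter.1 hB').2],
        prod_const]
      exact pow_le_pow_of_le_one (hδ0 _) (hδ1 _) (le_card_filter_octBoundary hC)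
    · intro B' hB'
      obtain ⟨T, -, h⟩ := mem_octBoundary.1 hB'
      rw [mem_ssubsets]
      refine ((image_subset_image h.1).trans_eq octFace_image).ssubset_of_ne fun heq => ?_
      have := card_image_le (s := B') (f := π)
      rw [heq] at this
      exact absurd (hKcard B' hB') (not_lt.2 this)
  · rw [octFace_image]
    have h := hcop (Fin r) id S.ssubsets ?_ ?_ (fun _ _ => Set.injOn_id _) ?_
    · refine h.trans ?_
      simp only [image_id]
      refine mul_le_mul_of_nonneg_right (hpow (hcardle _ ?_)) (prod_nonneg fun _ _ => hδ0 _)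
      rwa [Fintype.card_fin]
    · rw [Fintype.card_fin]
      have : 2 ^ (#S - 1) ≤ 2 ^ k := Nat.pow_le_pow_right two_pos (by omega)
      have := Nat.mul_le_mul_left r this
      omega
    · intro D hD D' hD'
      rw [mem_ssubsets] at *
      exact hD'.trans hD
    · intro D hD
      have := card_lt_card (mem_ssubsets.1 hD)
      omega
  · have h := hcop _ (Sum.elim π π) (doubleAlong (octFace S ∅) K) ?_
      (ssubsets_subset_doubleAlong hKdown) (fun D => injOn_of_mem_doubleAlong hKinj)
      (fun D => card_le_of_mem_doubleAlong fun B' hB' => by have := hKcard B' hB'; omega)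
    · refine h.trans (mul_le_mul_of_nonneg_right (hpow (hcardle _ ?_))
        (prod_nonneg fun _ _ => hδ0 _))
      rw [Fintype.card_sum, hW]; omega
    · rw [Fintype.card_sum, hW]
      exact hlevel _ (by omega)
  · rintro (B' | T) - y
    · exact abs_agree_le_one _ y
    · have h0 := agree_nonneg (Q := Q) (x₀ := x₀) (π := π) (octFace S T) y
      have h1 := agree_le_one (Q := Q) (x₀ := x₀) (π := π) (octFace S T) y
      simp only [Sum.elim_inr]
      rw [abs_le]
      constructor <;> linarith [hδ0 S, hδ1 S]
  · rintro (B' | T) -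
    · exact dependsOn_agree B'
    · intro y y' h
      simp only [Sum.elim_inr]
      rw [dependsOn_agree (octFace S T) h]
  · rintro (B' | T) hb
    · rw [inl_mem_disjSum] at hb
      intro h
      have h1 : #(octFace S ∅) ≤ #B' := card_le_card h
      have h2 := hKcard B' hb
      rw [hBcard] at h1
      omega
    · rw [inr_mem_disjSum, mem_erase, mem_powerset] at hb
      exact fun h => hb.1 (octFace_inj (empty_subset _) hb.2 h).symm
  · intro y
    rw [prod_disjSum, abs_mul]
    simp only [Sum.elim_inl, Sum.elim_inr]
    rw [abs_of_nonneg (prod_agree_nonneg K y), abs_prod]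
    refine mul_le_of_le_one_right (prod_agree_nonneg K y)
      (prod_le_one (fun _ _ => abs_nonneg _) fun T _ => ?_)
    have h0 := agree_nonneg (Q := Q) (x₀ := x₀) (π := π) (octFace S T) y
    have h1 := agree_le_one (Q := Q) (x₀ := x₀) (π := π) (octFace S T) y
    rw [abs_le]
    constructor <;> linarith [hδ0 S, hδ1 S]

end Octahedra

section Refinement

variable {X : Type*} [Fintype X] [DecidableEq X] {px : X → Fin r}

/-- In the definition of `CutUniform` the bounded functions may be replaced by signs. -/
lemma exists_sign_of_expect_mul_prod (C : Finset (Fin r)) (u : (Fin r → X) → ℝ)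
    (w : Fin r → (Fin r → X) → ℝ) (hw : ∀ i x, |w i x| ≤ 1)
    (hdep : ∀ i ∈ C, DependsOn (w i) ((C.erase i : Finset (Fin r)) : Set (Fin r)))
    (T : Finset (Fin r)) (hT : T ⊆ C) :
    ∃ w' : Fin r → (Fin r → X) → ℝ, (∀ i x, |w' i x| ≤ 1) ∧
      (∀ i ∈ C, DependsOn (w' i) ((C.erase i : Finset (Fin r)) : Set (Fin r))) ∧
      (∀ i ∈ T, ∀ x, w' i x = 1 ∨ w' i x = -1) ∧
      𝔼 x ∈ points px, u x * ∏ i ∈ C, w i x ≤ 𝔼 x ∈ points px, u x * ∏ i ∈ C, w' i x := by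
  induction T using Finset.induction_on with
  | empty => exact ⟨w, hw, hdep, by simp, le_rfl⟩
  | insert i T hi ih =>
    obtain ⟨w₁, hb, hd, hs, hle⟩ := ih ((subset_insert _ _).trans hT)
    have hiC : i ∈ C := hT (mem_insert_self i T)
    let v : (Fin r → X) → ℝ := fun x => u x * ∏ l ∈ C.erase i, w₁ l x
    let φ : (Fin r → X) → Finset X := fun x => (C.erase i).image x
    let σ : (Fin r → X) → ℝ := fun x => if 0 ≤ cellAvg (points px) φ v x then 1 else -1
    have hσ : ∀ x, σ x = 1 ∨ σ x = -1 := fun x => by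
      simp only [σ]; split_ifs <;> simp
    have hφ : ∀ x y, φ x = φ y → σ x = σ y := fun x y h => by
      simp only [σ, cellAvg_congr h]
    have hprod : ∀ (z : Fin r → (Fin r → X) → ℝ), (∀ l ∈ C.erase i, z l = w₁ l) → ∀ x,
        u x * ∏ l ∈ C, z l x = v x * z i x := by
      intro z hz x
      rw [← prod_erase_mul _ _ hiC, ← mul_assoc]
      congr 2
      exact prod_congr rfl fun l hl => by rw [hz l hl]
    refine ⟨Function.update w₁ i σ, ?_, ?_, ?_, hle.trans ?_⟩
    · intro l x
      rcases eq_or_ne l i with rfl | h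
      · rw [Function.update_self]
        rcases hσ x with h | h <;> simp [h]
      · rw [Function.update_of_ne h]; exact hb l x
    · intro l hl
      rcases eq_or_ne l i with rfl | h
      · rw [Function.update_self]
        exact fun x y hxy => hφ x y (image_congr hxy)
      · rw [Function.update_of_ne h]; exact hd l hl
    · intro l hl x
      rcases eq_or_ne l i with rfl | h
      · rw [Function.update_self]; exact hσ x
      · rw [Function.update_of_ne h]
        exact hs l ((mem_insert.1 hl).resolve_left h) x
    · have e1 : 𝔼 x ∈ points px, u x * ∏ l ∈ C, w₁ l x =
          𝔼 x ∈ points px, cellAvg (points px) φ v x * w₁ i x := by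
        rw [expect_cellAvg_mul fun x hx y hy hxy => hd i hiC fun l hl =>
          image_inj_of_mem_points hx hy hxy l hl]
        exact expect_congr rfl fun x _ => hprod w₁ (fun _ _ => rfl) x
      have e2 : 𝔼 x ∈ points px, u x * ∏ l ∈ C, Function.update w₁ i σ l x =
          𝔼 x ∈ points px, cellAvg (points px) φ v x * σ x := by
        rw [expect_cellAvg_mul fun x _ y _ hxy => hφ x y hxy]
        refine expect_congr rfl fun x _ => ?_
        rw [hprod (Function.update w₁ i σ) (fun l hl => by
          rw [Function.update_of_ne (mem_erase.1 hl).1]) x, Function.update_self]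
      rw [e1, e2]
      refine expect_le_expect fun x _ => ?_
      have h1 := abs_le.1 (hb i x)
      simp only [σ]
      split_ifs with h0
      · nlinarith
      · nlinarith

lemma exists_sign_of_not_cutUniform {C : Finset (Fin r)} (hC : C.Nonempty)
    {u : (Fin r → X) → ℝ} {θ : ℝ} (hu : ¬ CutUniform px C u θ) :
    ∃ w : Fin r → (Fin r → X) → ℝ,
      (∀ i ∈ C, DependsOn (w i) ((C.erase i : Finset (Fin r)) : Set (Fin r))) ∧
      (∀ i ∈ C, ∀ x, w i x = 1 ∨ w i x = -1) ∧
      θ ≤ 𝔼 x ∈ points px, u x * ∏ i ∈ C, w i x := by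
  unfold CutUniform at hu
  push Not at hu
  obtain ⟨w, hb, hd, hlt⟩ := hu
  have key : ∀ w : Fin r → (Fin r → X) → ℝ, (∀ i x, |w i x| ≤ 1) →
      (∀ i ∈ C, DependsOn (w i) ((C.erase i : Finset (Fin r)) : Set (Fin r))) →
      θ ≤ 𝔼 x ∈ points px, u x * ∏ i ∈ C, w i x → ∃ w : Fin r → (Fin r → X) → ℝ,
      (∀ i ∈ C, DependsOn (w i) ((C.erase i : Finset (Fin r)) : Set (Fin r))) ∧
      (∀ i ∈ C, ∀ x, w i x = 1 ∨ w i x = -1) ∧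
      θ ≤ 𝔼 x ∈ points px, u x * ∏ i ∈ C, w i x := by
    intro w hb hd hle
    obtain ⟨w', -, hd', hs, hle'⟩ := exists_sign_of_expect_mul_prod (px := px) C u w hb hd C
      subset_rfl
    exact ⟨w', hd', hs, hle.trans hle'⟩
  rcases lt_abs.1 hlt with h | h
  · exact key w hb hd h.le
  · obtain ⟨i, hi⟩ := hC
    refine key (Function.update w i (fun x => -w i x)) ?_ ?_ ?_
    · intro l x
      rcases eq_or_ne l i with rfl | hne
      · rw [Function.update_self, abs_neg]; exact hb l x
      · rw [Function.update_of_ne hne]; exact hb l x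
    · intro l hl
      rcases eq_or_ne l i with rfl | hne
      · rw [Function.update_self]
        intro x y hxy
        simp only [hd l hl hxy]
      · rw [Function.update_of_ne hne]; exact hd l hl
    · refine h.le.trans_eq ?_
      rw [← expect_neg_distrib]
      refine expect_congr rfl fun x _ => ?_
      have hp : ∏ l ∈ C.erase i, Function.update w i (fun x => -w i x) l x =
          ∏ l ∈ C.erase i, w l x :=
        prod_congr rfl fun l hl => by rw [Function.update_of_ne (mem_erase.1 hl).1]
      rw [← mul_prod_erase _ _ hi, ← mul_prod_erase _ _ hi, Function.update_self, hp]
      ring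

/-- `Q'` refines `Q` and differs from it only at the sets of size `ℓ`. -/
structure RefinesAt (ℓ : ℕ) (Q Q' : Finset (Fin r) → Finset X → ℕ) : Prop where
  eq_of_ne : ∀ D, #D ≠ ℓ → Q' D = Q D
  eq_of_eq : ∀ D F F', Q' D F = Q' D F' → Q D F = Q D F'

lemma RefinesAt.refl (ℓ : ℕ) (Q : Finset (Fin r) → Finset X → ℕ) : RefinesAt ℓ Q Q :=
  ⟨fun _ _ => rfl, fun _ _ _ h => h⟩

lemma RefinesAt.trans {ℓ : ℕ} {Q Q' Q'' : Finset (Fin r) → Finset X → ℕ}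
    (h : RefinesAt ℓ Q Q') (h' : RefinesAt ℓ Q' Q'') : RefinesAt ℓ Q Q'' :=
  ⟨fun D hD => (h'.eq_of_ne D hD).trans (h.eq_of_ne D hD),
    fun D F F' hF => h.eq_of_eq D F F' (h'.eq_of_eq D F F' hF)⟩

/-- The colours of the maximal proper faces at `C` of a point. -/
noncomputable def boundaryType (Q : Finset (Fin r) → Finset X → ℕ) (C : Finset (Fin r))
    (x : Fin r → X) : Fin r → ℕ :=
  fun i => if i ∈ C then Q (C.erase i) ((C.erase i).image x) else 0

lemma boundaryType_eq_iff {Q : Finset (Fin r) → Finset X → ℕ} {C : Finset (Fin r)}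
    {x y : Fin r → X} : boundaryType Q C x = boundaryType Q C y ↔
      ∀ i ∈ C, Q (C.erase i) ((C.erase i).image x) = Q (C.erase i) ((C.erase i).image y) := by
  rw [funext_iff]
  refine forall_congr' fun i => ?_
  by_cases hi : i ∈ C <;> simp [boundaryType, hi]

lemma RefinesAt.boundaryType_eq {ℓ : ℕ} {Q Q' : Finset (Fin r) → Finset X → ℕ}
    (h : RefinesAt ℓ Q Q') {C : Finset (Fin r)} {x y : Fin r → X}
    (hxy : boundaryType Q' C x = boundaryType Q' C y) :
    boundaryType Q C x = boundaryType Q C y := by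
  rw [boundaryType_eq_iff] at *
  exact fun i hi => h.eq_of_eq _ _ _ (hxy i hi)

variable {κ : Type*}

/-- The total energy of the functions `g t` relative to the partitions given by the colours of
the maximal proper faces at `C t`. -/
noncomputable def energy (px : X → Fin r) (Q : Finset (Fin r) → Finset X → ℕ) (I : Finset κ)
    (C : κ → Finset (Fin r)) (g : κ → (Fin r → X) → ℝ) : ℝ :=
  ∑ t ∈ I, 𝔼 x ∈ points px, cellAvg (points px) (boundaryType Q (C t)) (g t) x ^ 2

variable {I : Finset κ} {C : κ → Finset (Fin r)} {g : κ → (Fin r → X) → ℝ} {ℓ : ℕ}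
  {Q Q' : Finset (Fin r) → Finset X → ℕ}

lemma energy_nonneg : 0 ≤ energy px Q I C g :=
  sum_nonneg fun _ _ => expect_nonneg fun _ _ => sq_nonneg _

lemma energy_le_card (hne : (points px).Nonempty) (hg0 : ∀ t x, 0 ≤ g t x)
    (hg1 : ∀ t x, g t x ≤ 1) : energy px Q I C g ≤ #I := by
  rw [card_eq_sum_ones, Nat.cast_sum, Nat.cast_one]
  exact sum_le_sum fun t _ => expect_le hne fun x hx =>
    pow_le_one₀ (cellAvg_nonneg (hg0 t) x) (cellAvg_le_one (hg1 t) hx)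

lemma sum_expect_sub_sq_eq (h : RefinesAt ℓ Q Q') :
    ∑ t ∈ I, 𝔼 x ∈ points px, (cellAvg (points px) (boundaryType Q' (C t)) (g t) x -
      cellAvg (points px) (boundaryType Q (C t)) (g t) x) ^ 2 =
        energy px Q' I C g - energy px Q I C g := by
  rw [energy, energy, ← sum_sub_distrib]
  exact sum_congr rfl fun t _ =>
    expect_cellAvg_sq_of_refines fun x _ y _ hxy => h.boundaryType_eq hxy

lemma energy_mono (h : RefinesAt ℓ Q Q') : energy px Q I C g ≤ energy px Q' I C g := by
  rw [← sub_nonneg, ← sum_expect_sub_sq_eq h]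
  exact sum_nonneg fun _ _ => expect_nonneg fun _ _ => sq_nonneg _

/-- A failure of uniformity can be used to refine the partitions with an increase of energy. -/
lemma exists_refinesAt_of_not_cutUniform (hne : (points px).Nonempty)
    (hC : ∀ t ∈ I, #(C t) = ℓ + 1) {θ : ℝ} (hθ : 0 ≤ θ) {t : κ} (ht : t ∈ I)
    (hu : ¬ CutUniform px (C t)
      (fun x => g t x - cellAvg (points px) (boundaryType Q (C t)) (g t) x) θ) {m : ℕ}
    (hm : ∀ D F, #D = ℓ → Q D F < m) :
    ∃ Q', RefinesAt ℓ Q Q' ∧ (∀ D F, #D = ℓ → Q' D F < 2 * m) ∧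
      energy px Q I C g + θ ^ 2 ≤ energy px Q' I C g := by
  obtain ⟨w, hd, hs, hle⟩ := exists_sign_of_not_cutUniform
    (card_pos.1 (by rw [hC t ht]; exact Nat.succ_pos ℓ)) hu
  let mark : Finset (Fin r) → Finset X → Prop := fun D F =>
    ∃ i ∈ C t, D = (C t).erase i ∧ ∃ x ∈ points px, D.image x = F ∧ w i x = 1
  let Q' : Finset (Fin r) → Finset X → ℕ := fun D F =>
    if #D = ℓ then 2 * Q D F + (if mark D F then 1 else 0) else Q D F
  have hQ' : RefinesAt ℓ Q Q' := by
    constructor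
    · intro D hD
      funext F
      simp [Q', hD]
    · intro D F F' h
      simp only [Q'] at h
      split_ifs at h <;> omega
  have hmark : ∀ i ∈ C t, ∀ x ∈ points px,
      (mark ((C t).erase i) (((C t).erase i).image x) ↔ w i x = 1) := by
    intro i hi x hx
    constructor
    · rintro ⟨i', hi', hii', x', hx', him, h1⟩
      have hii : i' = i := by
        by_contra hne
        have : i' ∈ (C t).erase i := mem_erase.2 ⟨hne, hi'⟩
        rw [hii'] at this
        exact notMem_erase _ _ this
      subst hii
      rw [← h1]
      exact hd i' hi' fun l hl => (image_inj_of_mem_points hx' hx him l hl).symm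
    · exact fun h => ⟨i, hi, rfl, x, hx, rfl, h⟩
  have hw : ∀ x ∈ points px, ∀ y ∈ points px,
      boundaryType Q' (C t) x = boundaryType Q' (C t) y →
        ∏ i ∈ C t, w i x = ∏ i ∈ C t, w i y := by
    intro x hx y hy hxy
    rw [boundaryType_eq_iff] at hxy
    refine prod_congr rfl fun i hi => ?_
    have h := hxy i hi
    have hcard : #((C t).erase i) = ℓ := by rw [card_erase_of_mem hi, hC t ht]; rfl
    simp only [Q', hcard, if_true, hmark i hi x hx, hmark i hi y hy] at h
    have h1 := hs i hi x
    have h2 := hs i hi y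
    split_ifs at h with hx1 hy1 hy1
    · rw [hx1, hy1]
    · omega
    · omega
    · rw [h1.resolve_left hx1, h2.resolve_left hy1]
  refine ⟨Q', hQ', ?_, ?_⟩
  · intro D F hD
    have := hm D F hD
    simp only [Q', hD, if_true]
    split_ifs <;> omega
  · have hinc := energy_increment (s := points px) hθ hne
      (fun x _ y _ hxy => hQ'.boundaryType_eq (C := C t) hxy) hw (fun x => by
        rw [abs_prod]
        refine prod_le_one (fun _ _ => abs_nonneg _) fun i hi => ?_
        rcases hs i hi x with h | h <;> simp [h]) hle
    rw [energy, energy, ← add_sum_erase _ _ ht, ← add_sum_erase I _ ht]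
    have hrest := sum_le_sum (s := I.erase t) (f := fun t =>
      𝔼 x ∈ points px, cellAvg (points px) (boundaryType Q (C t)) (g t) x ^ 2)
      (g := fun t => 𝔼 x ∈ points px, cellAvg (points px) (boundaryType Q' (C t)) (g t) x ^ 2)
      fun t _ => by
        have := energy_mono (px := px) (I := {t}) (C := C) (g := g) hQ'
        simpa [energy] using this
    linarith

lemma exists_refinesAt_cutUniform (hne : (points px).Nonempty)
    (hC : ∀ t ∈ I, #(C t) = ℓ + 1) (hg0 : ∀ t x, 0 ≤ g t x) (hg1 : ∀ t x, g t x ≤ 1)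
    {θ : ℝ} (hθ : 0 ≤ θ) (n : ℕ) (Q : Finset (Fin r) → Finset X → ℕ) (m : ℕ)
    (hm : ∀ D F, #D = ℓ → Q D F < m) (hn : #I < energy px Q I C g + n * θ ^ 2) :
    ∃ Q', RefinesAt ℓ Q Q' ∧ (∀ D F, #D = ℓ → Q' D F < 2 ^ n * m) ∧
      ∀ t ∈ I, CutUniform px (C t)
        (fun x => g t x - cellAvg (points px) (boundaryType Q' (C t)) (g t) x) θ := by
  induction n generalizing Q m with
  | zero =>
    have := energy_le_card (Q := Q) (I := I) (C := C) hne hg0 hg1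
    simp only [Nat.cast_zero, zero_mul, add_zero] at hn
    linarith
  | succ n ih =>
    by_cases hu : ∀ t ∈ I, CutUniform px (C t)
        (fun x => g t x - cellAvg (points px) (boundaryType Q (C t)) (g t) x) θ
    · refine ⟨Q, RefinesAt.refl _ _, fun D F hD => (hm D F hD).trans_le ?_, hu⟩
      exact Nat.le_mul_of_pos_left m (by positivity)
    · push Not at hu
      obtain ⟨t, ht, hu⟩ := hu
      obtain ⟨Q₁, h1, hm1, he⟩ := exists_refinesAt_of_not_cutUniform hne hC hθ ht hu hm
      obtain ⟨Q₂, h2, hm2, hu2⟩ := ih Q₁ (2 * m) hm1 (by push_cast at hn; linarith)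
      refine ⟨Q₂, h1.trans h2, fun D F hD => ?_, hu2⟩
      have := hm2 D F hD
      rwa [pow_succ, mul_assoc]

end Refinement

/-- Strong regularity: the partitions may be refined in such a way that every `g t` is, up to
an error `e t` of small total energy, the sum of its projection and a function that is uniform
as a function of the number of colours used. -/
theorem exists_refinesAt_decomposition {κ : Type*} (I : Finset κ) (C : κ → Finset (Fin r))
    {ℓ : ℕ} (hC : ∀ t ∈ I, #(C t) = ℓ + 1) (Θ : ℕ → ℝ) (hΘ : ∀ m, 0 < Θ m) {ρ : ℝ}
    (hρ : 0 < ρ) (m₀ : ℕ) :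
    ∃ R : ℕ, ∀ (X : Type) [Fintype X] [DecidableEq X] (px : X → Fin r), (points px).Nonempty →
      ∀ (g : κ → (Fin r → X) → ℝ), (∀ t x, 0 ≤ g t x) → (∀ t x, g t x ≤ 1) →
      ∀ (Q : Finset (Fin r) → Finset X → ℕ), (∀ D F, #D = ℓ → Q D F < m₀) →
      ∃ (m : ℕ) (Q' : Finset (Fin r) → Finset X → ℕ) (e u : κ → (Fin r → X) → ℝ),
        m₀ ≤ m ∧ m ≤ R ∧ RefinesAt ℓ Q Q' ∧ (∀ D F, #D = ℓ → Q' D F < m) ∧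
        (∀ t ∈ I, CutUniform px (C t) (u t) (Θ m)) ∧
        (∀ t x, g t x = cellAvg (points px) (boundaryType Q' (C t)) (g t) x + e t x + u t x) ∧
        ∑ t ∈ I, 𝔼 x ∈ points px, e t x ^ 2 ≤ ρ := by
  have key : ∀ (n : ℕ) (m₀ : ℕ), ∃ R : ℕ, ∀ (X : Type) [Fintype X] [DecidableEq X]
      (px : X → Fin r), (points px).Nonempty →
      ∀ (g : κ → (Fin r → X) → ℝ), (∀ t x, 0 ≤ g t x) → (∀ t x, g t x ≤ 1) →
      ∀ (Q : Finset (Fin r) → Finset X → ℕ), (∀ D F, #D = ℓ → Q D F < m₀) →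
      #I < energy px Q I C g + n * ρ →
      ∃ (m : ℕ) (Q' : Finset (Fin r) → Finset X → ℕ) (e u : κ → (Fin r → X) → ℝ),
        m₀ ≤ m ∧ m ≤ R ∧ RefinesAt ℓ Q Q' ∧ (∀ D F, #D = ℓ → Q' D F < m) ∧
        (∀ t ∈ I, CutUniform px (C t) (u t) (Θ m)) ∧
        (∀ t x, g t x = cellAvg (points px) (boundaryType Q' (C t)) (g t) x + e t x + u t x) ∧
        ∑ t ∈ I, 𝔼 x ∈ points px, e t x ^ 2 ≤ ρ := by
    intro n
    induction n with
    | zero =>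
      refine fun m₀ => ⟨0, fun X _ _ px hne g hg0 hg1 Q _ hn => ?_⟩
      have := energy_le_card (Q := Q) (I := I) (C := C) hne hg0 hg1
      simp only [Nat.cast_zero, zero_mul, add_zero] at hn
      linarith
    | succ n ih =>
      intro m₀
      obtain ⟨n₁, hn₁⟩ := exists_nat_gt (#I / Θ m₀ ^ 2 : ℝ)
      obtain ⟨R, hR⟩ := ih (2 ^ n₁ * m₀)
      refine ⟨max m₀ R, fun X _ _ px hne g hg0 hg1 Q hm hn => ?_⟩
      have hpos : 0 < Θ m₀ ^ 2 := pow_pos (hΘ m₀) 2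
      rw [div_lt_iff₀ hpos] at hn₁
      obtain ⟨Q₂, h2, hm2, hu2⟩ := exists_refinesAt_cutUniform hne hC hg0 hg1 (hΘ m₀).le n₁ Q m₀
        hm (by have := energy_nonneg (px := px) (Q := Q) (I := I) (C := C) (g := g); linarith)
      by_cases he : energy px Q₂ I C g ≤ energy px Q I C g + ρ
      · refine ⟨m₀, Q, fun t x => cellAvg (points px) (boundaryType Q₂ (C t)) (g t) x -
          cellAvg (points px) (boundaryType Q (C t)) (g t) x,
          fun t x => g t x - cellAvg (points px) (boundaryType Q₂ (C t)) (g t) x, le_rfl,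
          le_max_left _ _, RefinesAt.refl _ _, hm, hu2, fun t x => by ring, ?_⟩
        rw [sum_expect_sub_sq_eq h2]
        linarith
      · push Not at he
        obtain ⟨m, Q', e, u, h1, h3, h4, h5⟩ := hR X px hne g hg0 hg1 Q₂ hm2
          (by push_cast at hn; linarith)
        exact ⟨m, Q', e, u, (Nat.le_mul_of_pos_left m₀ (by positivity)).trans h1,
          h3.trans (le_max_right _ _), h2.trans h4, h5⟩
  obtain ⟨n, hn⟩ := exists_nat_gt (#I / ρ : ℝ)
  rw [div_lt_iff₀ hρ] at hn
  obtain ⟨R, hR⟩ := key n m₀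
  refine ⟨R, fun X _ _ px hne g hg0 hg1 Q hm => hR X px hne g hg0 hg1 Q hm ?_⟩
  have := energy_nonneg (px := px) (Q := Q) (I := I) (C := C) (g := g)
  linarith

section Exceptional

variable {Ω β γ : Type*} {s : Finset Ω}

lemma card_filter_small_cell_le {φ : Ω → β} {ψ : Ω → γ} {T : Finset γ} (hψ : ∀ x ∈ s, ψ x ∈ T)
    {c : ℝ} (hc : 0 ≤ c) :
    (#{x ∈ s | (#{y ∈ s | φ y = φ x ∧ ψ y = ψ x} : ℝ) < c * #{y ∈ s | φ y = φ x}} : ℝ) ≤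
      c * #T * #s := by
  set U := {x ∈ s | (#{y ∈ s | φ y = φ x ∧ ψ y = ψ x} : ℝ) < c * #{y ∈ s | φ y = φ x}} with hU
  have hUs : U ⊆ s := filter_subset _ _
  have h1 : ∀ a ∈ T, ∀ b ∈ s.image φ,
      (#{x ∈ {x ∈ U | ψ x = a} | φ x = b} : ℝ) ≤ c * #{y ∈ s | φ y = b} := by
    intro a _ b _
    rcases {x ∈ {x ∈ U | ψ x = a} | φ x = b}.eq_empty_or_nonempty with h | ⟨x, hx⟩
    · rw [h, card_empty, Nat.cast_zero]; positivity
    · simp only [mem_filter] at hx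
      obtain ⟨⟨hxU, rfl⟩, rfl⟩ := hx
      refine le_trans ?_ (mem_filter.1 hxU).2.le
      refine Nat.cast_le.2 (card_le_card fun y hy => ?_)
      simp only [mem_filter] at hy ⊢
      exact ⟨hUs hy.1.1, hy.2, hy.1.2⟩
  rw [card_eq_sum_card_fiberwise (f := ψ) (t := T) fun x hx => hψ x (hUs hx)]
  push_cast
  calc ∑ a ∈ T, (#{x ∈ U | ψ x = a} : ℝ) ≤ ∑ _a ∈ T, c * #s := by
        refine sum_le_sum fun a ha => ?_
        rw [card_eq_sum_card_fiberwise (f := φ) (t := s.image φ) fun x hx =>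
            mem_image_of_mem φ (hUs (mem_filter.1 hx).1),
          card_eq_sum_card_fiberwise (s := s) (f := φ) (t := s.image φ) fun x hx =>
            mem_image_of_mem φ hx]
        push_cast
        rw [mul_sum]
        exact sum_le_sum (h1 a ha)
    _ = c * #T * #s := by rw [sum_const, nsmul_eq_mul]; ring

lemma card_filter_lt_cellAvg_le {φ : Ω → β} {g : Ω → ℝ} (hg : ∀ x, 0 ≤ g x) {τ ρ : ℝ}
    (hρ : 𝔼 x ∈ s, g x ≤ ρ) : τ * #{x ∈ s | τ < cellAvg s φ g x} ≤ ρ * #s := by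
  rcases s.eq_empty_or_nonempty with rfl | hne
  · simp
  have hs : (0 : ℝ) < #s := Nat.cast_pos.2 hne.card_pos
  rw [← expect_cellAvg (φ := φ), expect_eq_sum_div_card, div_le_iff₀ hs] at hρ
  refine le_trans ?_ hρ
  rw [mul_comm, ← nsmul_eq_mul, ← sum_const]
  calc ∑ _x ∈ s with τ < cellAvg s φ g _x, τ
      ≤ ∑ x ∈ s with τ < cellAvg s φ g x, cellAvg s φ g x :=
        sum_le_sum fun x hx => (mem_filter.1 hx).2.le
    _ ≤ ∑ x ∈ s, cellAvg s φ g x :=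
        sum_le_sum_of_subset_of_nonneg (filter_subset _ _) fun x _ _ => cellAvg_nonneg hg x

end Exceptional

section Regular

variable {X : Type*} [Fintype X] [DecidableEq X] {px : X → Fin r}
  {Q : Finset (Fin r) → Finset X → ℕ} {x₀ : Fin r → X} {C : Finset (Fin r)} {c τ θ : ℝ}

lemma regularAt_empty (hx₀ : x₀ ∈ points px) (hc : c ≤ 1) (hτ : 0 ≤ τ) (hθ : 0 ≤ θ) :
    RegularAt px Q x₀ ∅ c τ θ := by
  refine ⟨by rwa [faceDensity_empty hx₀], 0, 0, ?_, ?_, ?_⟩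
  · intro w _ _
    simpa using hθ
  · simpa using mul_nonneg hτ (copies_nonneg (px := px) (Q := Q) (x₀ := x₀) (π := id) _)
  · intro x _ _
    simp [faceDensity_empty hx₀, agree]

/-- The colours of the proper faces at `C` of a point. -/
noncomputable def faceType (Q : Finset (Fin r) → Finset X → ℕ) (C : Finset (Fin r))
    (x : Fin r → X) : Finset (Fin r) → ℕ :=
  fun D => if D ∈ C.ssubsets then Q D (D.image x) else 0

lemma agree_id_eq_one_iff {D : Finset (Fin r)} {x : Fin r → X} :
    agree Q x₀ id D x = 1 ↔ Q D (D.image x) = Q D (D.image x₀) := by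
  rw [agree_eq_one_iff, image_id]

lemma faceType_eq_iff {x : Fin r → X} :
    faceType Q C x = faceType Q C x₀ ↔ ∏ D ∈ C.ssubsets, agree Q x₀ id D x = 1 := by
  rw [prod_agree_eq_one_iff, funext_iff]
  refine forall_congr' fun D => ?_
  by_cases hD : D ∈ C.ssubsets <;> simp [faceType, hD, agree_id_eq_one_iff]

lemma copies_ssubsets_eq : copies px Q x₀ id C.ssubsets =
    (#{x ∈ points px | faceType Q C x = faceType Q C x₀} : ℝ) / #(points px) := by
  rw [copies_eq_card_div]
  congr 3
  ext x
  rw [mem_filter, mem_filter, faceType_eq_iff, prod_agree_eq_one_iff]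

lemma copies_powerset_eq : copies px Q x₀ id C.powerset =
    (#{x ∈ points px | faceType Q C x = faceType Q C x₀ ∧
      Q C (C.image x) = Q C (C.image x₀)} : ℝ) / #(points px) := by
  rw [copies_eq_card_div]
  congr 3
  ext x
  rw [mem_filter, mem_filter, faceType_eq_iff, prod_agree_eq_one_iff]
  refine and_congr_right fun _ => ⟨fun h => ⟨fun D hD => h D ?_, ?_⟩, fun h D hD => ?_⟩
  · exact mem_powerset.2 (mem_ssubsets.1 hD).1
  · exact agree_id_eq_one_iff.1 (h C (mem_powerset_self C))
  · rcases (mem_powerset.1 hD).eq_or_ssubset with rfl | h'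
    · exact agree_id_eq_one_iff.2 h.2
    · exact h.1 D (mem_ssubsets.2 h')

lemma expect_prod_agree_mul_le {e g : (Fin r → X) → ℝ} (hx₀ : x₀ ∈ points px)
    (heg : ∀ x, e x ≤ g x) (hg : cellAvg (points px) (faceType Q C) g x₀ ≤ τ) :
    𝔼 x ∈ points px, (∏ D ∈ C.ssubsets, agree Q x₀ id D x) * e x ≤
      τ * copies px Q x₀ id C.ssubsets := by
  have hcell : (0 : ℝ) < #{x ∈ points px | faceType Q C x = faceType Q C x₀} :=
    Nat.cast_pos.2 (card_pos.2 ⟨x₀, by simp [hx₀]⟩)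
  rw [cellAvg, expect_eq_sum_div_card] at hg
  have hg' : ∑ x ∈ points px with faceType Q C x = faceType Q C x₀, g x ≤
      τ * #{x ∈ points px | faceType Q C x = faceType Q C x₀} := by
    rw [← div_le_iff₀ hcell]; exact le_of_eq_of_le (by congr!) hg
  rw [copies_ssubsets_eq, expect_eq_sum_div_card, ← mul_div_assoc]
  gcongr
  refine le_trans ?_ hg'
  rw [sum_filter]
  refine sum_le_sum fun x _ => ?_
  split_ifs with h
  · rw [faceType_eq_iff.1 h, one_mul]; exact heg x
  · rcases prod_agree_eq_zero_or_one (Q := Q) (x₀ := x₀) (π := id) C.ssubsets x with h0 | h1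
    · rw [h0, zero_mul]
    · exact absurd (faceType_eq_iff.2 h1) h

lemma abs_expect_prod_agree_mul_le {u : (Fin r → X) → ℝ} (hu : CutUniform px C u θ) :
    |𝔼 x ∈ points px, (∏ D ∈ C.ssubsets, agree Q x₀ id D x) * u x| ≤ θ := by
  simp_rw [mul_comm _ (u _)]
  refine hu.abs_expect_mul_prod_le _ _ (fun D _ x => abs_agree_le_one D x) fun D hD => ?_
  obtain ⟨hDC, hCD⟩ := mem_ssubsets.1 hD
  obtain ⟨i, hi, hiD⟩ := not_subset.1 hCD
  exact ⟨i, hi, fun x y hxy => dependsOn_agree D fun l hl =>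
    hxy l (mem_coe.2 (mem_erase.2 ⟨fun h => hiD (h ▸ hl), hDC hl⟩))⟩

/-- A decomposition in which the structured part is an arbitrary constant gives regularity. -/
theorem regularAt_of_decomposition (hx₀ : x₀ ∈ points px) (hc : c ≤ faceDensity px Q x₀ C)
    {e u : (Fin r → X) → ℝ} {d Θ b : ℝ} (hu : CutUniform px C u Θ) (hΘ : Θ ≤ θ) (hb : 0 ≤ b)
    (hΘb : Θ ^ 2 ≤ τ / 2 * b ^ 2) (hbμ : b ≤ copies px Q x₀ id C.ssubsets)
    (he : 𝔼 x ∈ points px, (∏ D ∈ C.ssubsets, agree Q x₀ id D x) * e x ^ 2 ≤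
      τ / 2 * copies px Q x₀ id C.ssubsets)
    (hdec : ∀ x ∈ points px, ∏ D ∈ C.ssubsets, agree Q x₀ id D x = 1 →
      agree Q x₀ id C x = d + e x + u x) : RegularAt px Q x₀ C c τ θ := by
  refine ⟨hc, fun x => e x + (d - faceDensity px Q x₀ C), u, fun w hw hd => (hu w hw hd).trans hΘ,
    ?_, fun x hx h => by rw [hdec x hx h]; ring⟩
  set h : (Fin r → X) → ℝ := fun x => ∏ D ∈ C.ssubsets, agree Q x₀ id D x with hh
  set μ := copies px Q x₀ id C.ssubsets with hμ
  set δ := faceDensity px Q x₀ C with hδ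
  have hμ0 : 0 < μ := copies_pos hx₀ _
  have hμE : 𝔼 x ∈ points px, h x = μ := rfl
  have hpow : 𝔼 x ∈ points px, h x * agree Q x₀ id C x = δ * μ := by
    rw [hδ, faceDensity, ← hμ, div_mul_cancel₀ _ hμ0.ne', copies]
    refine expect_congr rfl fun x _ => ?_
    rw [← prod_erase_mul _ _ (mem_powerset_self C)]
    rfl
  set A := 𝔼 x ∈ points px, h x * e x with hA
  set U := 𝔼 x ∈ points px, h x * u x with hU
  have hUΘ : |U| ≤ Θ := abs_expect_prod_agree_mul_le hu
  have hsum : δ * μ = d * μ + A + U := by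
    rw [← hpow, ← hμE, hA, hU, mul_expect, ← expect_add_distrib, ← expect_add_distrib]
    refine expect_congr rfl fun x hx => ?_
    rcases prod_agree_eq_zero_or_one (Q := Q) (x₀ := x₀) (π := id) C.ssubsets x with h0 | h1
    · have : h x = 0 := h0
      rw [this]; ring
    · rw [hdec x hx h1]; ring
  have hexp : 𝔼 x ∈ points px, h x * (e x + (d - δ)) ^ 2 =
      (𝔼 x ∈ points px, h x * e x ^ 2) + 2 * (d - δ) * A + (d - δ) ^ 2 * μ := by
    rw [← hμE, hA, mul_expect, mul_expect, ← expect_add_distrib, ← expect_add_distrib]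
    exact expect_congr rfl fun x _ => by ring
  have hU2 : U ^ 2 ≤ τ / 2 * b ^ 2 := by
    refine le_trans ?_ hΘb
    rw [← sq_abs]
    exact pow_le_pow_left₀ (abs_nonneg _) hUΘ 2
  have hτ : 0 ≤ τ / 2 := by
    by_contra hneg
    push Not at hneg
    have : (0 : ℝ) ≤ 𝔼 x ∈ points px, h x * e x ^ 2 :=
      expect_nonneg fun x _ => mul_nonneg (prod_agree_nonneg _ _) (sq_nonneg _)
    nlinarith
  have hU3 : U ^ 2 ≤ τ / 2 * μ ^ 2 := hU2.trans (by gcongr)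
  change 𝔼 x ∈ points px, h x * (e x + (d - δ)) ^ 2 ≤ τ * μ
  rw [hexp]
  have hA' : A = -((d - δ) * μ) - U := by linarith
  rw [hA']
  have key : -((d - δ) ^ 2 * μ) - 2 * (d - δ) * U ≤ τ / 2 * μ := by
    refine le_of_mul_le_mul_right ?_ hμ0
    nlinarith [sq_nonneg ((d - δ) * μ + U)]
  nlinarith

end Regular

section Levels

variable {X : Type*} [Fintype X] [DecidableEq X] {px : X → Fin r}
  {Q : Finset (Fin r) → Finset X → ℕ} {C : Finset (Fin r)}

lemma card_image_faceType_le {M : ℕ} (hM0 : 0 < M) (hM : ∀ D ⊂ C, ∀ F, Q D F < M)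
    (x : Fin r → X) : faceType Q C x ∈ Fintype.piFinset fun _ : Finset (Fin r) => range M := by
  rw [Fintype.mem_piFinset]
  intro D
  rw [mem_range, faceType]
  split_ifs with hD
  · exact hM D (mem_ssubsets.1 hD) _
  · exact hM0

/-- Few points fail to be regular at `C` when the indicators of the colours at `C` have
decompositions with uniform and small parts. -/
theorem card_filter_not_regularAt_le {m M : ℕ} {α c τ θ Θ b : ℝ}
    {p e u : ℕ → (Fin r → X) → ℝ} (hm : ∀ F, Q C F < m) (hM0 : 0 < M)
    (hM : ∀ D ⊂ C, ∀ F, Q D F < M) (hc : 0 ≤ c) (hcm : c * m ≤ α) (hb : 0 ≤ b)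
    (hbM : b * M ^ 2 ^ r ≤ α) (hτ : 0 < τ)
    (he : ∑ a ∈ range m, 𝔼 x ∈ points px, e a x ^ 2 ≤ τ / 2 * α)
    (hu : ∀ a < m, CutUniform px C (u a) Θ) (hΘ : Θ ≤ θ) (hΘb : Θ ^ 2 ≤ τ / 2 * b ^ 2)
    (hp : ∀ a x y, faceType Q C x = faceType Q C y → p a x = p a y)
    (hdec : ∀ a x, (if Q C (C.image x) = a then 1 else 0) = p a x + e a x + u a x) :
    (#{x₀ ∈ points px | ¬ RegularAt px Q x₀ C c τ θ} : ℝ) ≤ 3 * α * #(points px) := by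
  set s := points px with hs
  set g : (Fin r → X) → ℝ := fun x => ∑ a ∈ range m, e a x ^ 2 with hg
  set φ := faceType Q C (X := X) with hφ
  set U₁ := {x ∈ s | (#{y ∈ s | φ y = φ x ∧ Q C (C.image y) = Q C (C.image x)} : ℝ) <
    c * #{y ∈ s | φ y = φ x}} with hU₁
  set U₂ := {x ∈ s | (#{y ∈ s | () = () ∧ φ y = φ x} : ℝ) < b * #{y ∈ s | () = ()}} with hU₂
  set U₃ := {x ∈ s | τ / 2 < cellAvg s φ g x} with hU₃
  have h1 : (#U₁ : ℝ) ≤ α * #s := by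
    have h := card_filter_small_cell_le (s := s) (φ := φ) (ψ := fun x => Q C (C.image x))
      (T := range m) (fun x _ => mem_range.2 (hm _)) hc
    rw [card_range] at h
    refine le_trans (le_of_eq_of_le (by rw [hU₁]; congr!) h) ?_
    gcongr
  have h2 : (#U₂ : ℝ) ≤ α * #s := by
    have h := card_filter_small_cell_le (s := s) (φ := fun _ => ()) (ψ := φ)
      (T := Fintype.piFinset fun _ : Finset (Fin r) => range M)
      (fun x _ => card_image_faceType_le hM0 hM x) hb
    rw [Fintype.card_piFinset, prod_const, card_range, card_univ, Fintype.card_finset,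
      Fintype.card_fin] at h
    push_cast at h
    refine le_trans (le_of_eq_of_le (by rw [hU₂]; congr!) h) ?_
    gcongr
  have h3 : (#U₃ : ℝ) ≤ α * #s := by
    have h := card_filter_lt_cellAvg_le (s := s) (φ := φ) (g := g)
      (fun x => sum_nonneg fun _ _ => sq_nonneg _) (τ := τ / 2) (ρ := τ / 2 * α)
      (by rw [hg, expect_sum_comm]; exact he)
    rw [mul_assoc] at h
    exact le_of_mul_le_mul_left h (by positivity)
  have hsub : {x₀ ∈ s | ¬ RegularAt px Q x₀ C c τ θ} ⊆ U₁ ∪ U₂ ∪ U₃ := by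
    intro x₀ hx
    obtain ⟨hx₀, hreg⟩ := mem_filter.1 hx
    by_contra hnot
    simp only [mem_union, not_or] at hnot
    obtain ⟨⟨n1, n2⟩, n3⟩ := hnot
    apply hreg
    have n1' := not_lt.1 fun h => n1 (mem_filter.2 ⟨hx₀, h⟩)
    have n2' := not_lt.1 fun h => n2 (mem_filter.2 ⟨hx₀, h⟩)
    have n3' := not_lt.1 fun h => n3 (mem_filter.2 ⟨hx₀, h⟩)
    have hn : (0 : ℝ) < #s := Nat.cast_pos.2 (card_pos.2 ⟨x₀, hx₀⟩)
    have hcell : (0 : ℝ) < #{y ∈ s | φ y = φ x₀} :=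
      Nat.cast_pos.2 (card_pos.2 ⟨x₀, by simp [hx₀]⟩)
    have ha := hm (C.image x₀)
    refine regularAt_of_decomposition (d := p (Q C (C.image x₀)) x₀)
      (e := e (Q C (C.image x₀))) (u := u (Q C (C.image x₀))) hx₀ ?_ (hu _ ha) hΘ hb hΘb ?_ ?_ ?_
    · rw [faceDensity, copies_powerset_eq, copies_ssubsets_eq, div_div_div_cancel_right₀ hn.ne',
        le_div_iff₀ hcell]
      exact n1'
    · rw [copies_ssubsets_eq, le_div_iff₀ hn]
      simpa using n2'
    · refine expect_prod_agree_mul_le hx₀ (g := g) (fun x => ?_) n3'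
      exact single_le_sum (f := fun a => e a x ^ 2) (fun _ _ => sq_nonneg _) (mem_range.2 ha)
    · intro x _ h
      rw [hp _ x₀ x (faceType_eq_iff.2 h).symm, ← hdec, agree, image_id]
  calc (#{x₀ ∈ s | ¬ RegularAt px Q x₀ C c τ θ} : ℝ) ≤ #U₁ + #U₂ + #U₃ := by
        refine (Nat.cast_le.2 (card_le_card hsub)).trans ?_
        have := (card_union_le (U₁ ∪ U₂) U₃).trans (Nat.add_le_add_right (card_union_le U₁ U₂) _)
        exact_mod_cast this
    _ ≤ 3 * α * #s := by linarith

end Levels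

section Construction

/-- The square error permitted at density `c` when the count is to have relative error `ξ`. -/
noncomputable def squareError (L : ℕ) (ξ : ℝ) : ℝ := (ξ / 2 ^ L) ^ 2

lemma exists_pos_le_of_forall_pos {f : ℕ → ℝ} (hf : ∀ m, 0 < f m) (R : ℕ) :
    ∃ δ > 0, ∀ m ≤ R, δ ≤ f m := by
  refine ⟨(range (R + 1)).inf' nonempty_range_add_one f, ?_, fun m hm => ?_⟩
  · exact (lt_inf'_iff _).2 fun m _ => hf m
  · exact inf'_le _ (mem_range.2 (Nat.lt_succ_of_le hm))

/-- The partitions at the levels below `j` may be refined so that at each set of size at most `j`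
almost every point is regular. -/
theorem exists_refinement_regularAt {L : ℕ} {ξ : ℕ → ℝ → ℝ} (hξ : ∀ i a, 0 < a → 0 < ξ i a)
    {α : ℝ} (hα : 0 < α) (hα1 : α ≤ 1) (j : ℕ) : ∀ m₀ : ℕ, ∃ (M : ℕ) (δ : ℝ), 0 < δ ∧
    ∀ (X : Type) [Fintype X] [DecidableEq X] (px : X → Fin r), (points px).Nonempty →
      ∀ q : Finset (Fin r) → Finset X → ℕ, (∀ D F, #D ≤ j → q D F < m₀) →
      ∃ (Q : Finset (Fin r) → Finset X → ℕ) (c : ℕ → ℝ),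
        (∀ D, j ≤ #D → Q D = q D) ∧ (∀ D F F', Q D F = Q D F' → q D F = q D F') ∧
        (∀ D F, #D ≤ j → Q D F < M) ∧ Monotone c ∧ (∀ i, j ≤ i → c i = α / (m₀ + 1)) ∧
        δ ≤ c 0 ∧ (∀ i, 0 < c i) ∧ (∀ i, c i ≤ 1) ∧
        ∀ C : Finset (Fin r), #C ≤ j →
          (#{x₀ ∈ points px | ¬ RegularAt px Q x₀ C (c #C) (squareError L (ξ #C (c #C)))
            (ξ #C (c #C) * c 0 ^ L)} : ℝ) ≤ 3 * α * #(points px) := by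
  induction j with
  | zero =>
    intro m₀
    have hc : 0 < α / (m₀ + 1 : ℝ) := by positivity
    have hc1 : α / (m₀ + 1 : ℝ) ≤ 1 := div_le_one_of_le₀ (by
      have : (0 : ℝ) ≤ m₀ := Nat.cast_nonneg _
      linarith) (by positivity)
    refine ⟨m₀, α / (m₀ + 1), hc, fun X _ _ px _ q hq => ⟨q, fun _ => α / (m₀ + 1),
      fun _ _ => rfl, fun _ _ _ h => h, hq, monotone_const, fun _ _ => rfl, le_rfl, fun _ => hc,
      fun _ => hc1, fun C hC => ?_⟩⟩
    obtain rfl := card_eq_zero.1 (Nat.le_zero.1 hC)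
    rw [filter_false_of_mem, card_empty, Nat.cast_zero]
    · positivity
    · exact fun x hx => not_not.2 (regularAt_empty hx hc1 (sq_nonneg _)
        (mul_nonneg (hξ _ _ hc).le (pow_nonneg hc.le _)))
  | succ ℓ ih =>
    intro m₀
    choose Mℓ δℓ hδℓ hih using ih
    set a : ℝ := α / (m₀ + 1) with ha
    have hm₀ : (0 : ℝ) ≤ m₀ := Nat.cast_nonneg _
    have ha0 : 0 < a := by positivity
    have ha1 : a ≤ 1 := div_le_one_of_le₀ (by linarith) (by positivity)
    set σ : ℝ := ξ (ℓ + 1) a / 2 ^ L with hσ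
    have hξa : 0 < ξ (ℓ + 1) a := hξ _ _ ha0
    have hσ0 : 0 < σ := by positivity
    set b : ℕ → ℝ := fun m => α / (Mℓ m + 1 : ℕ) ^ 2 ^ r with hb
    have hb0 : ∀ m, 0 < b m := fun m => by positivity
    set Θ : ℕ → ℝ := fun m => min (ξ (ℓ + 1) a * δℓ m ^ L) (σ / 2 * b m) with hΘ
    have hΘ0 : ∀ m, 0 < Θ m := fun m =>
      lt_min (mul_pos hξa (pow_pos (hδℓ m) _)) (mul_pos (half_pos hσ0) (hb0 m))
    obtain ⟨R, hR⟩ := exists_refinesAt_decomposition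
      ((univ.filter fun C : Finset (Fin r) => #C = ℓ + 1) ×ˢ range m₀)
      (fun t : Finset (Fin r) × ℕ => t.1) (ℓ := ℓ)
      (fun t ht => (mem_filter.1 (mem_product.1 ht).1).2) Θ hΘ0
      (ρ := σ ^ 2 / 2 * α) (by positivity) m₀
    obtain ⟨δ, hδ0, hδ⟩ := exists_pos_le_of_forall_pos hδℓ R
    refine ⟨m₀ + ∑ m ∈ range (R + 1), Mℓ m, δ, hδ0, fun X _ _ px hne q hq => ?_⟩
    obtain ⟨m, Q', e, u, hm₀m, hmR, href, hQ', hu, hdec, he⟩ := hR X px hne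
      (fun t x => if q t.1 (t.1.image x) = t.2 then 1 else 0)
      (fun t x => by split_ifs <;> norm_num) (fun t x => by split_ifs <;> norm_num) q
      (fun D F hD => hq D F (by omega))
    obtain ⟨Q, c', hQe, hQr, hQM, hmono, hctop, hc'δ, hc'0, hc'1, hreg⟩ := hih m X px hne Q'
      (fun D F hD => by
        rcases hD.eq_or_lt with h | h
        · exact hQ' D F h
        · rw [href.eq_of_ne D h.ne]
          exact (hq D F (by omega)).trans_le hm₀m)
    have hcle : ∀ i, i ≤ ℓ → c' i ≤ a := fun i hi => by
      refine (hmono hi).trans ?_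
      rw [hctop ℓ le_rfl, ha]
      gcongr
    have hQq : ∀ D, ℓ + 1 ≤ #D → Q D = q D := fun D hD => by
      rw [hQe D (by omega), href.eq_of_ne D (by omega)]
    have hMle : Mℓ m ≤ m₀ + ∑ m ∈ range (R + 1), Mℓ m :=
      (single_le_sum (f := Mℓ) (fun _ _ => Nat.zero_le _)
        (mem_range.2 (Nat.lt_succ_of_le hmR))).trans (Nat.le_add_left _ _)
    refine ⟨Q, fun i => if i ≤ ℓ then c' i else a, hQq,
      fun D F F' h => href.eq_of_eq _ _ _ (hQr _ _ _ h), ?_, ?_, ?_, ?_, ?_, ?_, ?_⟩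
    · intro D F hD
      rcases hD.lt_or_eq with h | h
      · exact (hQM D F (by omega)).trans_le hMle
      · rw [hQq D h.ge]
        exact (hq D F hD).trans_le (Nat.le_add_right _ _)
    · intro i i' hii'
      dsimp only
      split_ifs with h h'
      · exact hmono hii'
      · exact hcle i h
      · omega
      · exact le_rfl
    · intro i hi
      dsimp only
      rw [if_neg (by omega)]
    · dsimp only
      rw [if_pos (Nat.zero_le _)]
      exact (hδ m hmR).trans hc'δ
    · intro i
      dsimp only
      split_ifs
      · exact hc'0 i
      · exact ha0
    · intro i
      dsimp only
      split_ifs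
      · exact hc'1 i
      · exact ha1
    · intro C hC
      rcases hC.lt_or_eq with h | h
      · have hCℓ : #C ≤ ℓ := by omega
        simpa only [if_pos hCℓ, if_pos (Nat.zero_le ℓ)] using hreg C hCℓ
      · have hCℓ : ¬ #C ≤ ℓ := by omega
        simp only [if_neg hCℓ, if_pos (Nat.zero_le ℓ)]
        rw [h]
        have hCI : ∀ a < m₀, (C, a) ∈
            (univ.filter fun C : Finset (Fin r) => #C = ℓ + 1) ×ˢ range m₀ := fun a ha =>
          mem_product.2 ⟨mem_filter.2 ⟨mem_univ _, h⟩, mem_range.2 ha⟩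
        refine card_filter_not_regularAt_le (m := m₀) (M := Mℓ m + 1) (Θ := Θ m) (b := b m)
          (p := fun a => cellAvg (points px) (boundaryType Q' C)
            (fun x => if q C (C.image x) = a then 1 else 0))
          (e := fun a => e (C, a)) (u := fun a => u (C, a)) ?_ (Nat.succ_pos _) ?_ ha0.le ?_
          (hb0 m).le ?_ (by rw [squareError]; positivity) ?_ ?_ ?_ ?_ ?_ ?_
        · intro F
          rw [hQq C h.ge]
          exact hq C F hC
        · intro D hD F
          have := card_lt_card hD
          exact (hQM D F (by omega)).trans (Nat.lt_succ_self _)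
        · rw [ha, div_mul_eq_mul_div, div_le_iff₀ (by positivity)]
          nlinarith
        · rw [hb]
          exact (div_mul_cancel₀ _ (by positivity)).le
        · refine le_trans ?_ he
          rw [sum_product]
          exact single_le_sum
            (f := fun C => ∑ a ∈ range m₀, 𝔼 x ∈ points px, e (C, a) x ^ 2)
            (fun _ _ => sum_nonneg fun _ _ => expect_nonneg fun _ _ => sq_nonneg _)
            (mem_filter.2 ⟨mem_univ _, h⟩)
        · exact fun a ha => hu (C, a) (hCI a ha)
        · refine (min_le_left _ _).trans ?_
          have := (hδℓ m).le
          gcongr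
        · refine (pow_le_pow_left₀ (hΘ0 m).le (min_le_right _ _) 2).trans ?_
          rw [squareError, ← hσ, mul_pow]
          refine mul_le_mul_of_nonneg_right ?_ (sq_nonneg _)
          nlinarith [sq_nonneg σ]
        · intro a x y hxy
          refine cellAvg_congr (boundaryType_eq_iff.2 fun i hi => ?_)
          have hmem : C.erase i ∈ C.ssubsets := mem_ssubsets.2 (erase_ssubset hi)
          have hx := congrFun hxy (C.erase i)
          simp only [faceType, if_pos hmem] at hx
          rwa [hQe _ (by rw [card_erase_of_mem hi]; omega)] at hx
        · intro a x
          rw [hQq C h.ge]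
          exact hdec (C, a) x

end Construction

section Parameters

variable {ε : ℝ} {k nJ : ℕ} {P P' : ℕ → ℝ}

lemma epsSeq_pos (hε : 0 < ε) (hJ : 0 < nJ) (hP : ∀ m, 0 < P m) (j : ℕ) :
    0 < epsSeq ε k nJ P j := by
  induction j with
  | zero => exact hε
  | succ j ih =>
    rw [epsSeq]
    have := hP (k - j)
    positivity

lemma etaSeq_pos (hε : 0 < ε) (hJ : 0 < nJ) (hP : ∀ m, 0 < P m) (j : ℕ) :
    0 < etaSeq ε k nJ P j := by
  rw [etaSeq]
  have := epsSeq_pos (k := k) hε hJ hP j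
  have := hP (k - j)
  positivity

lemma epsSeq_mono (hε : 0 < ε) (hJ : 0 < nJ) (hP : ∀ m, 0 < P m) {j : ℕ}
    (h : ∀ i ≤ j, P (k - i) ≤ P' (k - i)) : epsSeq ε k nJ P j ≤ epsSeq ε k nJ P' j := by
  induction j with
  | zero => exact le_rfl
  | succ j ih =>
    have h1 := ih fun i hi => h i (by omega)
    have h2 := h j (by omega)
    have h3 := epsSeq_pos (k := k) hε hJ hP j
    have h4 := hP (k - j)
    have h5 := h3.le.trans h1
    rw [epsSeq, epsSeq]
    gcongr

lemma etaSeq_mono (hε : 0 < ε) (hJ : 0 < nJ) (hP : ∀ m, 0 < P m) {j : ℕ}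
    (h : ∀ i ≤ j, P (k - i) ≤ P' (k - i)) : etaSeq ε k nJ P j ≤ etaSeq ε k nJ P' j := by
  have h1 := epsSeq_mono (nJ := nJ) hε hJ hP h
  have h2 := h j le_rfl
  have h3 := epsSeq_pos (k := k) hε hJ hP j
  have h4 := hP (k - j)
  have h5 := h3.le.trans h1
  rw [etaSeq, etaSeq]
  gcongr

/-- The relative error permitted at the level `i` when the densities from that level on are at
least `a`. -/
noncomputable def countError (ε : ℝ) (k nJ L i : ℕ) (a : ℝ) : ℝ :=
  1 / 2 * (min 1 (etaSeq ε k nJ (fun _ => a ^ nJ) (k - i)) * a ^ L)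

lemma countError_pos (hε : 0 < ε) (hJ : 0 < nJ) (L i : ℕ) {a : ℝ} (ha : 0 < a) :
    0 < countError ε k nJ L i a := by
  have := etaSeq_pos (k := k) (P := fun _ => a ^ nJ) hε hJ (fun _ => pow_pos ha _) (k - i)
  rw [countError]
  positivity

lemma compatible_countError (hε : 0 < ε) (hJ : 0 < nJ) (L : ℕ) {c : ℕ → ℝ} (hc : Monotone c)
    (hc0 : ∀ i, 0 < c i) (hc1 : ∀ i, c i ≤ 1) :
    Compatible L c (fun i => countError ε k nJ L i (c i))
      (fun i => squareError L (countError ε k nJ L i (c i)))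
      (fun i => countError ε k nJ L i (c i) * c 0 ^ L) where
  mono := hc
  pos := hc0
  le_one := hc1
  err_pos i := countError_pos hε hJ L i (hc0 i)
  err_le i := by
    rw [countError, ← mul_assoc, mul_one_div_cancel two_ne_zero, one_mul]
    exact mul_le_of_le_one_left (pow_nonneg (hc0 i).le _) (min_le_left _ _)
  sq_nonneg i := sq_nonneg _
  sq_le i := by
    rw [squareError, div_pow, sq ((2 : ℝ) ^ L), div_mul_cancel₀ _ (by positivity)]
  cut_le i := le_rfl

variable {E X : Type*} [Fintype E] [DecidableEq E] [Fintype X] [DecidableEq X] {pe : E → Fin r}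
  {J : Finset (Finset E)} {px : X → Fin r} {Q : Finset (Fin r) → Finset X → ℕ} {x₀ : Fin r → X}

/-- If every face of `x₀` is regular then the chain of `x₀` is quasirandom. -/
theorem chainQuasirandom_of_regularAt (hJ : IsPartiteChain pe J) (hJk : ∀ A ∈ J, #A ≤ k)
    (hε : 0 < ε) (hJ0 : 0 < #J) {N L : ℕ} (hN : r * 2 ^ k * 2 ≤ N) (hkN : k ≤ N) (hL : L = 2 ^ N)
    {c : ℕ → ℝ} (hc : Monotone c) (hc0 : ∀ i, 0 < c i) (hc1 : ∀ i, c i ≤ 1)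
    (hx₀ : x₀ ∈ points px)
    (hreg : ∀ C : Finset (Fin r), #C ≤ k → RegularAt px Q x₀ C (c #C)
      (squareError L (countError ε k #J L #C (c #C))) (countError ε k #J L #C (c #C) * c 0 ^ L)) :
    ChainQuasirandom ε k pe J px (chainOf px k Q x₀) := by
  subst hL
  intro A hA hAk
  have hcard : ∀ B ∈ J, #(B.image pe) = #B := fun B hB => card_image_of_injOn (hJ.1 B hB)
  set S := A.image pe with hS
  have hSA : #S = #A := hcard A hA
  have hSk : #S ≤ k := hSA.trans_le hAk
  rw [octNorm_chainOf hx₀ hSk]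
  refine (oct_devFun_le (compatible_countError hε hJ0 (2 ^ N) hc hc0 hc1) hN hx₀ hSk
    fun C hC => hreg C (hC.trans hSk)).trans ?_
  have hsplit : ∏ C ∈ S.powerset, faceDensity px Q x₀ C ^ 2 ^ #C =
      (∏ C ∈ S.ssubsets, faceDensity px Q x₀ C ^ 2 ^ #C) * faceDensity px Q x₀ S ^ 2 ^ #S := by
    rw [← prod_erase_mul _ _ (mem_powerset_self S)]
    rfl
  rw [hsplit, mul_comm (∏ C ∈ S.ssubsets, faceDensity px Q x₀ C ^ 2 ^ #C), ← mul_assoc]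
  refine mul_le_mul_of_nonneg_right ?_
    (prod_nonneg fun C _ => pow_nonneg (faceDensity_nonneg C) _)
  have hca := hc0 #S
  have hη := etaSeq_pos (k := k) (P := fun _ => c #S ^ #J) hε hJ0 (fun _ => pow_pos hca _)
    (k - #S)
  have hηle : etaSeq ε k #J (fun _ => c #S ^ #J) (k - #S) ≤
      etaSeq ε k #J (fun m => prodDelta px (chainOf px k Q x₀) pe J m) (k - #A) := by
    rw [hSA]
    refine etaSeq_mono hε hJ0 (fun _ => pow_pos (hc0 _) _) fun i hi => ?_
    refine pow_le_prod_of_le (hc0 _).le (hc1 _) (fun B hB => ?_) (card_le_card (filter_subset _ _))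
    obtain ⟨hBJ, hB⟩ := mem_filter.1 hB
    have hBk : #(B.image pe) ≤ k := (hcard B hBJ).trans_le (hJk B hBJ)
    rw [relDensity_chainOf hx₀ hBk]
    refine le_trans ?_ (hreg _ hBk).1
    rw [hcard B hBJ]
    exact hc (by omega)
  rw [countError, ← mul_assoc, mul_one_div_cancel two_ne_zero, one_mul]
  refine mul_le_mul ((min_le_right _ _).trans hηle) ?_ (pow_nonneg hca.le _) (hη.le.trans hηle)
  calc c #S ^ 2 ^ N ≤ c #S ^ 2 ^ #S :=
        pow_le_pow_of_le_one hca.le (hc1 _) (Nat.pow_le_pow_right two_pos (hSk.trans hkN))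
    _ ≤ faceDensity px Q x₀ S ^ 2 ^ #S := by
        have := (hreg S hSk).1
        gcongr

/-- The rank of the colour of `F` among the colours used on `completeK px A`. -/
noncomputable def colourRank (px : X → Fin r) (P : Finset (Fin r) → Finset X → ℕ)
    (A : Finset (Fin r)) (F : Finset X) : ℕ :=
  #{v ∈ (completeK px A).image (P A) | v < P A F}

lemma colourRank_eq_iff {P : Finset (Fin r) → Finset X → ℕ} {A : Finset (Fin r)} {F F' : Finset X}
    (hF : F ∈ completeK px A) (hF' : F' ∈ completeK px A) :
    colourRank px P A F = colourRank px P A F' ↔ P A F = P A F' := by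
  have key : ∀ G G', G ∈ completeK px A → P A G < P A G' →
      colourRank px P A G < colourRank px P A G' := by
    intro G G' hG hlt
    refine card_lt_card ⟨fun v hv => ?_, fun hsub => ?_⟩
    · rw [mem_filter] at hv ⊢
      exact ⟨hv.1, hv.2.trans hlt⟩
    · exact lt_irrefl _ (mem_filter.1 (hsub (mem_filter.2 ⟨mem_image_of_mem _ hG, hlt⟩))).2
  refine ⟨fun h => ?_, fun h => by rw [colourRank, colourRank, h]⟩
  rcases lt_trichotomy (P A F) (P A F') with h' | h' | h'
  · exact absurd h (key F F' hF h').ne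
  · exact h'
  · exact absurd h (key F' F hF' h').ne'

end Parameters

/-- **Theorem 7.3: the regularity lemma for `r`-partite chains.** Let `J` be an `r`-partite
`k`-chain containing, for each `A ⊆ [r]` of size at most `k`, a copy of the double octahedron
of dimension `|A|`, and let `0 < ε ≤ |J|^{−1}`.  For any prescribed partition sizes
`n A` there is a bound `M` such that: for any finite vertex sets (`X` with part map `px`) and
any system of partitions `P A` of the complete hypergraphs `K(A)` into at most `n A` cells,
there are refinements `Q A` of the `P A`, equal to `P A` when `|A| = k` and having at most
`M` cells, such that for a uniformly random partite point `x` the chain `H(x)` of the induced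
chain decomposition is `(ε, J, k)`-quasirandom with probability at least `1 − ε`. -/
theorem chain_regularity_lemma {r k : ℕ}
    (E : Type) [Fintype E] [DecidableEq E] (pe : E → Fin r)
    (J : Finset (Finset E)) (hJ : IsPartiteChain pe J) (hJk : ∀ A ∈ J, A.card ≤ k)
    (hDO : ∀ A : Finset (Fin r), A.card ≤ k →
      ∃ ι : Fin A.card × Fin 3 → E, Function.Injective ι ∧
        (∃ σ : Fin A.card → Fin r, Function.Injective σ ∧ (∀ i, σ i ∈ A) ∧
          ∀ p : Fin A.card × Fin 3, pe (ι p) = σ p.1) ∧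
        ∀ B ∈ doubleOct A.card, B.image ι ∈ J)
    (ε : ℝ) (hε0 : 0 < ε) (hε1 : ε ≤ ((J.card : ℝ))⁻¹)
    (n : Finset (Fin r) → ℕ) :
    ∃ M : ℕ, ∀ (X : Type) [Fintype X] [DecidableEq X], ∀ (px : X → Fin r)
      (P : Finset (Fin r) → Finset X → ℕ),
      (∀ A : Finset (Fin r), A.card ≤ k → ((completeK px A).image (P A)).card ≤ n A) →
      ∃ Q : Finset (Fin r) → Finset X → ℕ,
        (∀ A : Finset (Fin r), A.card ≤ k → ∀ F ∈ completeK px A, ∀ F' ∈ completeK px A,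
          Q A F = Q A F' → P A F = P A F') ∧
        (∀ A : Finset (Fin r), A.card = k → ∀ F ∈ completeK px A, ∀ F' ∈ completeK px A,
          (Q A F = Q A F' ↔ P A F = P A F')) ∧
        (∀ A : Finset (Fin r), A.card ≤ k → ((completeK px A).image (Q A)).card ≤ M) ∧
        (1 - ε) * ((univ.filter fun x : Fin r → X => ∀ i, px (x i) = i).card : ℝ) ≤
          ((univ.filter fun x : Fin r → X => (∀ i, px (x i) = i) ∧
            ChainQuasirandom ε k pe J px (chainOf px k Q x)).card : ℝ) := by
  have hJ0 : 0 < #J := by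
    refine Nat.pos_of_ne_zero fun h => ?_
    rw [h, Nat.cast_zero, inv_zero] at hε1
    linarith
  have hε1' : ε ≤ 1 := hε1.trans (inv_le_one_of_one_le₀ (Nat.one_le_cast.2 hJ0))
  set N := r * 2 ^ k * 2 + k with hN
  set α : ℝ := ε / (3 * 2 ^ r) with hα
  have hα0 : 0 < α := by positivity
  have hα1 : α ≤ 1 := div_le_one_of_le₀ (hε1'.trans (by
    have : (1 : ℝ) ≤ 2 ^ r := one_le_pow₀ one_le_two
    linarith)) (by positivity)
  obtain ⟨M, δ, -, hM⟩ := exists_refinement_regularAt (r := r) (L := 2 ^ N)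
    (ξ := fun i a => countError ε k #J (2 ^ N) i a)
    (fun i a ha => countError_pos hε0 hJ0 _ i ha) hα0 hα1 k (∑ A, n A + 1)
  have hn : ∀ A, n A ≤ ∑ A, n A := fun A =>
    single_le_sum (f := n) (fun _ _ => Nat.zero_le _) (mem_univ A)
  refine ⟨M + ∑ A, n A, fun X _ _ px P hP => ?_⟩
  have hpts : (univ.filter fun x : Fin r → X => ∀ i, px (x i) = i) = points px := by
    ext x
    rw [mem_partiteMaps, mem_filter]
    exact and_iff_right (mem_univ x)
  rw [hpts]
  rcases (points px).eq_empty_or_nonempty with he | hne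
  · refine ⟨P, fun _ _ _ _ _ _ h => h, fun _ _ _ _ _ _ => Iff.rfl,
      fun A hA => (hP A hA).trans ((hn A).trans (Nat.le_add_left _ _)), ?_⟩
    rw [he, card_empty, Nat.cast_zero, mul_zero]
    exact Nat.cast_nonneg _
  obtain ⟨Q, c, hQk, hQr, hQM, hc, -, -, hc0, hc1, hreg⟩ := hM X px hne (colourRank px P)
    (fun A F hA => Nat.lt_succ_of_le
      ((card_le_card (filter_subset _ _)).trans ((hP A hA).trans (hn A))))
  refine ⟨Q, fun A _ F hF F' hF' h => (colourRank_eq_iff hF hF').1 (hQr A F F' h),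
    fun A hA F hF F' hF' => ?_, fun A hA => ?_, ?_⟩
  · rw [hQk A hA.ge]
    exact colourRank_eq_iff hF hF'
  · refine (card_le_card (image_subset_iff.2 fun F _ => mem_range.2 (hQM A F hA))).trans ?_
    rw [card_range]
    exact Nat.le_add_right _ _
  set bad : Finset (Fin r) → Finset (Fin r → X) := fun C => {x₀ ∈ points px |
    ¬ RegularAt px Q x₀ C (c #C) (squareError (2 ^ N) (countError ε k #J (2 ^ N) #C (c #C)))
      (countError ε k #J (2 ^ N) #C (c #C) * c 0 ^ 2 ^ N)} with hbad
  set good := univ.filter fun x : Fin r → X => (∀ i, px (x i) = i) ∧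
    ChainQuasirandom ε k pe J px (chainOf px k Q x) with hgood
  have hcover : points px ⊆ good ∪ (univ.filter fun C : Finset (Fin r) => #C ≤ k).biUnion bad := by
    intro x hx
    rw [mem_union, or_iff_not_imp_right]
    intro hx'
    refine mem_filter.2 ⟨mem_univ _, mem_partiteMaps.1 hx,
      chainQuasirandom_of_regularAt hJ hJk hε0 hJ0 (Nat.le_add_right _ _) (Nat.le_add_left _ _)
        rfl hc hc0 hc1 hx fun C hC => ?_⟩
    by_contra hCx
    exact hx' (mem_biUnion.2 ⟨C, mem_filter.2 ⟨mem_univ _, hC⟩, mem_filter.2 ⟨hx, hCx⟩⟩)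
  have hbadcard : (#((univ.filter fun C : Finset (Fin r) => #C ≤ k).biUnion bad) : ℝ) ≤
      ε * #(points px) := by
    calc (#((univ.filter fun C : Finset (Fin r) => #C ≤ k).biUnion bad) : ℝ)
        ≤ ∑ C with #C ≤ k, (#(bad C) : ℝ) := by exact_mod_cast card_biUnion_le
      _ ≤ ∑ C : Finset (Fin r) with #C ≤ k, 3 * α * #(points px) :=
          sum_le_sum fun C hC => hreg C (mem_filter.1 hC).2
      _ ≤ ∑ _C : Finset (Fin r), 3 * α * #(points px) :=
          sum_le_sum_of_subset_of_nonneg (filter_subset _ _) fun _ _ _ => by positivity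
      _ = ε * #(points px) := by
          rw [sum_const, card_univ, Fintype.card_finset, Fintype.card_fin, nsmul_eq_mul, hα]
          push_cast
          field_simp
  have hcard : (#(points px) : ℝ) ≤
      #good + #((univ.filter fun C : Finset (Fin r) => #C ≤ k).biUnion bad) := by
    exact_mod_cast (card_le_card hcover).trans (card_union_le _ _)
  linarith
end

section
/- Let U be a finite nonempty set and let f and g be functions from U to the interval [−1,1]. Let B_1,…,B_r be a partition of U and suppose that g is constant on each B_i and that g is not identically zero. Then the mean-square density of f with respect to the partition B_1,…,B_r is at least ⟨f,g⟩²/‖g‖₂², where ⟨f,g⟩ = E_{x∈U} f(x)g(x) and ‖g‖₂² = E_{x∈U} g(x)². (Lemma 6.1.) -/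
open Finset

/-- **Lemma 6.1.** Let `U` be a finite nonempty set, `f, g : U → [−1,1]`, and let
`B 0, …, B (m−1)` be a partition of `U` on each cell of which `g` is constant, with `g` not
identically zero.  Then the mean-square density of `f` with respect to the partition,
`∑ i (|B i|/|U|)·(E_{x ∈ B i} f x)²`, is at least `⟨f,g⟩²/‖g‖₂²`, where
`⟨f,g⟩ = E_{x ∈ U} f x · g x` and `‖g‖₂² = E_{x ∈ U} (g x)²`. -/
theorem mean_square_density_lower_bound (U : Type) [Fintype U] [DecidableEq U] [Nonempty U]
    (f g : U → ℝ)
    (hf : ∀ x, f x ∈ Set.Icc (-1 : ℝ) 1) (hg : ∀ x, g x ∈ Set.Icc (-1 : ℝ) 1)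
    (m : ℕ) (B : Fin m → Finset U)
    (hdisj : ∀ i j, i ≠ j → Disjoint (B i) (B j))
    (hcover : ∀ x : U, ∃ i, x ∈ B i)
    (hconst : ∀ i, ∀ x ∈ B i, ∀ y ∈ B i, g x = g y)
    (hgne : ∃ x, g x ≠ 0) :
    ((∑ x, f x * g x) / (Fintype.card U : ℝ)) ^ 2 /
        ((∑ x, g x ^ 2) / (Fintype.card U : ℝ)) ≤
      ∑ i, (((B i).card : ℝ) / (Fintype.card U : ℝ)) *
        ((∑ x ∈ B i, f x) / ((B i).card : ℝ)) ^ 2 := by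
  have hsum : ∀ h : U → ℝ, ∑ x, h x = ∑ i, ∑ x ∈ B i, h x := by
    intro h
    rw [← Finset.sum_biUnion fun i _ j _ hij => hdisj i j hij]
    congr 1
    ext x
    simpa using hcover x
  have hval : ∀ i, ∃ c : ℝ, ∀ x ∈ B i, g x = c := by
    intro i
    rcases (B i).eq_empty_or_nonempty with hB | ⟨y, hy⟩
    · exact ⟨0, by simp [hB]⟩
    · exact ⟨g y, fun x hx => hconst i x hx y hy⟩
  choose c hc using hval
  have hn : (0 : ℝ) < Fintype.card U := by exact_mod_cast Fintype.card_pos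
  have hinner : (∑ x, f x * g x) / (Fintype.card U : ℝ) =
      ∑ i, c i * (∑ x ∈ B i, f x) / (Fintype.card U : ℝ) := by
    rw [hsum, Finset.sum_div]
    refine Finset.sum_congr rfl fun i _ => ?_
    rw [Finset.mul_sum]
    congr 1
    exact Finset.sum_congr rfl fun x hx => by rw [hc i x hx, mul_comm]
  have hnorm : (∑ x, g x ^ 2) / (Fintype.card U : ℝ) =
      ∑ i, c i ^ 2 * ((B i).card : ℝ) / (Fintype.card U : ℝ) := by
    rw [hsum, Finset.sum_div]
    refine Finset.sum_congr rfl fun i _ => ?_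
    rw [Finset.sum_congr rfl fun x hx => by rw [hc i x hx], Finset.sum_const, nsmul_eq_mul,
      mul_comm]
  have hpos : 0 < (∑ x, g x ^ 2) / (Fintype.card U : ℝ) := by
    obtain ⟨x, hx⟩ := hgne
    exact div_pos (Finset.sum_pos' (fun y _ => sq_nonneg (g y))
      ⟨x, Finset.mem_univ x, by positivity⟩) hn
  rw [div_le_iff₀ hpos, hinner, hnorm, mul_comm]
  refine Finset.sum_sq_le_sum_mul_sum_of_sq_le_mul _ (fun i _ => by positivity)
    (fun i _ => by positivity) fun i _ => le_of_eq ?_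
  rcases (B i).eq_empty_or_nonempty with hB | hB
  · simp [hB]
  · have hcard : ((B i).card : ℝ) ≠ 0 := by exact_mod_cast hB.card_pos.ne'
    field_simp
end

section
/- Let n be a positive integer, let 0 < δ < 1 and let r be an integer with r ≥ δ^{−1}. Let v_1,…,v_n be vectors in a real inner product space such that ‖v_i‖² ≤ 1 for each i and such that ‖(1/n)∑_{i=1}^n v_i‖² ≤ δ. Then the average, over all functions ψ: {1,…,r} → {1,…,n}, of ‖(1/r)∑_{j=1}^r v_{ψ(j)}‖² is at most 2δ. (Lemma 6.2: if r vectors w_1,…,w_r are chosen uniformly and independently from among v_1,…,v_n, then the expectation of ‖(1/r)∑_j w_j‖² is at most 2δ.) -/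
open Finset

theorem Fintype.sum_fin_succ_arrow {ι M : Type*} [Fintype ι] [AddCommMonoid M] (r : ℕ)
    (f : (Fin (r + 1) → ι) → M) :
    ∑ ψ, f ψ = ∑ i, ∑ ψ : Fin r → ι, f (Fin.cons i ψ) := by
  rw [← (Fin.consEquiv fun _ => ι).sum_comp, Fintype.sum_prod_type]
  rfl

section SampleSums

variable {ι V : Type*} [Fintype ι] [NormedAddCommGroup V] [InnerProductSpace ℝ V]

/-- The sum, over all samples of size `r`, of the sample sums of `v`, where `m` is the mean
of `v`. -/
theorem sum_sample_sum (v : ι → V) (m : V) (hm : ∑ i, v i = (Fintype.card ι : ℝ) • m)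
    (r : ℕ) :
    ∑ ψ : Fin r → ι, ∑ j, v (ψ j) = ((Fintype.card ι : ℝ) ^ r * r) • m := by
  induction r with
  | zero => simp
  | succ r ih =>
    simp only [Fintype.sum_fin_succ_arrow, Fin.sum_univ_succ, Fin.cons_zero, Fin.cons_succ,
      sum_add_distrib, ih, sum_const, card_univ, Fintype.card_fun, Fintype.card_fin, ← smul_sum,
      hm, ← Nat.cast_smul_eq_nsmul ℝ, smul_smul, ← add_smul]
    congr 1
    push_cast
    ring

/-- The sum, over all samples of size `r`, of the squared norms of the sample sums of `v`, where
`m` is the mean of `v` and `a` is the mean of the `‖v i‖ ^ 2`. -/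
theorem sum_norm_sq_sample_sum (v : ι → V) (m : V) (a : ℝ)
    (hm : ∑ i, v i = (Fintype.card ι : ℝ) • m)
    (ha : ∑ i, ‖v i‖ ^ 2 = Fintype.card ι * a) (r : ℕ) :
    ∑ ψ : Fin r → ι, ‖∑ j, v (ψ j)‖ ^ 2 =
      (Fintype.card ι : ℝ) ^ r * (r * a + r * (r - 1) * ‖m‖ ^ 2) := by
  induction r with
  | zero => simp
  | succ r ih =>
    simp only [Fintype.sum_fin_succ_arrow, Fin.sum_univ_succ, Fin.cons_zero, Fin.cons_succ,
      norm_add_sq_real, sum_add_distrib, ih, ← mul_sum, ← inner_sum, ← sum_inner,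
      sum_sample_sum v m hm, hm, ha, sum_const, card_univ, Fintype.card_fun, Fintype.card_fin,
      nsmul_eq_mul, real_inner_smul_left, real_inner_smul_right, real_inner_self_eq_norm_sq]
    push_cast
    ring

end SampleSums

/-- **Lemma 6.2.** Let `n` be a positive integer, `0 < δ < 1` and let `r` be an integer with
`r ≥ δ^{−1}`.  Let `v 1, …, v n` be vectors in a real inner product space with `‖v i‖² ≤ 1`
for each `i` and `‖(1/n)·∑ i, v i‖² ≤ δ`.  If `r` vectors `w j = v (ψ j)` are chosen
uniformly and independently from the `v i` (i.e. we average over all maps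
`ψ : Fin r → Fin n`), then the expectation of `‖(1/r)·∑ j, w j‖²` is at most `2δ`. -/
theorem random_selection_lemma (n : ℕ) (hn : 0 < n) (δ : ℝ) (hδ0 : 0 < δ) (hδ1 : δ < 1)
    (r : ℕ) (hr : δ⁻¹ ≤ (r : ℝ))
    (V : Type) [NormedAddCommGroup V] [InnerProductSpace ℝ V]
    (v : Fin n → V) (hv : ∀ i, ‖v i‖ ^ 2 ≤ 1)
    (havg : ‖(n : ℝ)⁻¹ • ∑ i, v i‖ ^ 2 ≤ δ) :
    (∑ ψ : Fin r → Fin n, ‖(r : ℝ)⁻¹ • ∑ j, v (ψ j)‖ ^ 2) /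
        (Fintype.card (Fin r → Fin n) : ℝ) ≤ 2 * δ := by
  have hn' : (0 : ℝ) < n := by exact_mod_cast hn
  have hr' : (0 : ℝ) < r := (inv_pos.2 hδ0).trans_le hr
  set m : V := (n : ℝ)⁻¹ • ∑ i, v i with hm
  set a : ℝ := (n : ℝ)⁻¹ * ∑ i, ‖v i‖ ^ 2 with ha
  have ha1 : a ≤ 1 := by
    rw [ha, inv_mul_le_iff₀ hn']
    simpa using sum_le_sum fun i (_ : i ∈ univ) => hv i
  have key := sum_norm_sq_sample_sum v m a (by simp [hm, smul_smul, hn'.ne'])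
    (by rw [ha, Fintype.card_fin, mul_inv_cancel_left₀ hn'.ne']) r
  have hrδ : 1 ≤ r * δ := (inv_le_iff_one_le_mul₀ hδ0).1 hr
  simp only [norm_smul, mul_pow, ← mul_sum, key, norm_inv, Real.norm_natCast, Fintype.card_fun,
    Fintype.card_fin, Nat.cast_pow]
  rw [div_le_iff₀ (by positivity), inv_pow, inv_mul_le_iff₀ (by positivity)]
  have bound : r * a + r * (r - 1) * ‖m‖ ^ 2 ≤ (r : ℝ) ^ 2 * (2 * δ) := by
    have h₁ : r * a ≤ r * (r * δ) := by gcongr; exact ha1.trans hrδ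
    have h₂ : (r : ℝ) ^ 2 * ‖m‖ ^ 2 ≤ r ^ 2 * δ := by gcongr
    have h₃ : 0 ≤ r * ‖m‖ ^ 2 := by positivity
    linarith
  calc _ ≤ (n : ℝ) ^ r * ((r : ℝ) ^ 2 * (2 * δ)) := by gcongr
    _ = _ := by ring
end

section
/- Let P = {X_1,…,X_r} and Q = {Y_1,…,Y_s} be two partitions of a finite nonempty set U, and let Q' be a refinement of Q. Then the mean-square density of P with respect to Q' is at least as great as the mean-square density of P with respect to Q. (Lemma 8.1.) -/
open Finset

namespace Finpartition

variable {α : Type*} [DecidableEq α] {s : Finset α} {Q Q' : Finpartition s}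

theorem biUnion_filter_subset_of_le (h : Q' ≤ Q) {Y : Finset α} (hY : Y ∈ Q.parts) :
    (Q'.parts.filter (· ⊆ Y)).biUnion id = Y := by
  ext a
  simp only [mem_biUnion, mem_filter, id]
  refine ⟨fun ⟨B, ⟨_, hBY⟩, ha⟩ ↦ hBY ha, fun ha ↦ ?_⟩
  obtain ⟨B, hB, haB⟩ := Q'.exists_mem (Q.subset hY ha)
  obtain ⟨C, hC, hBC⟩ := h hB
  obtain rfl : C = Y := Q.eq_of_mem_parts hC hY (hBC haB) ha
  exact ⟨B, ⟨hB, hBC⟩, haB⟩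

theorem sum_card_inter_filter_subset_of_le (h : Q' ≤ Q) {Y : Finset α} (hY : Y ∈ Q.parts)
    (X : Finset α) : ∑ B ∈ Q'.parts with B ⊆ Y, #(X ∩ B) = #(X ∩ Y) := by
  conv_rhs => rw [← biUnion_filter_subset_of_le h hY, inter_biUnion]
  refine (card_biUnion fun B hB C hC hBC ↦ ?_).symm
  exact (Q'.disjoint (mem_filter.1 hB).1 (mem_filter.1 hC).1 hBC).mono
    inter_subset_right inter_subset_right

theorem sum_sum_filter_subset_of_le {M : Type*} [AddCommMonoid M] (h : Q' ≤ Q)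
    (f : Finset α → M) :
    ∑ Y ∈ Q.parts, ∑ B ∈ Q'.parts with B ⊆ Y, f B = ∑ B ∈ Q'.parts, f B := by
  rw [← sum_biUnion]
  · congr 1
    ext B
    simp only [mem_biUnion, mem_filter]
    refine ⟨fun ⟨_, _, hB, _⟩ ↦ hB, fun hB ↦ ?_⟩
    obtain ⟨C, hC, hBC⟩ := h hB
    exact ⟨C, hC, hB, hBC⟩
  · intro Y hY Z hZ hYZ
    refine disjoint_left.2 fun B hBY hBZ ↦ hYZ ?_
    obtain ⟨hB, hBY⟩ := mem_filter.1 hBY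
    obtain ⟨a, ha⟩ := Q'.nonempty_of_mem_parts hB
    exact Q.eq_of_mem_parts hY hZ (hBY ha) ((mem_filter.1 hBZ).2 ha)

/-- Cauchy–Schwarz, applied to the cells of `Q'` inside a cell `Y` of `Q`. -/
theorem sq_card_inter_div_card_le_of_le (h : Q' ≤ Q) {Y : Finset α} (hY : Y ∈ Q.parts)
    (X : Finset α) :
    (#(X ∩ Y) : ℝ) ^ 2 / #Y ≤ ∑ B ∈ Q'.parts with B ⊆ Y, (#(X ∩ B) : ℝ) ^ 2 / #B := by
  have hcard : ∑ B ∈ Q'.parts with B ⊆ Y, #B = #Y := by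
    conv_rhs => rw [← inter_self Y, ← sum_card_inter_filter_subset_of_le h hY Y]
    exact sum_congr rfl fun B hB ↦ by rw [inter_eq_right.2 (mem_filter.1 hB).2]
  rw [← sum_card_inter_filter_subset_of_le h hY X, ← hcard]
  push_cast
  refine sq_sum_div_le_sum_sq_div _ _ fun B hB ↦ ?_
  exact_mod_cast (Q'.nonempty_of_mem_parts (mem_filter.1 hB).1).card_pos

end Finpartition

/-- **Lemma 8.1.** Let `P` and `Q` be two partitions of a finite nonempty set `U`, and let
`Q'` be a refinement of `Q`.  Then the mean-square density of `P` with respect to `Q'`,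
`∑_{X ∈ P} ∑_{Y ∈ Q'} (|Y|/|U|)·(|X ∩ Y|/|Y|)²`, is at least as great as the mean-square
density of `P` with respect to `Q`. -/
theorem mean_square_density_mono (U : Type) [Fintype U] [DecidableEq U] [Nonempty U]
    (P Q Q' : Finpartition (univ : Finset U))
    (href : ∀ B ∈ Q'.parts, ∃ C ∈ Q.parts, B ⊆ C) :
    ∑ Y ∈ Q.parts, ∑ Xc ∈ P.parts,
        ((Y.card : ℝ) / (Fintype.card U : ℝ)) * (((Xc ∩ Y).card : ℝ) / (Y.card : ℝ)) ^ 2 ≤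
      ∑ Y ∈ Q'.parts, ∑ Xc ∈ P.parts,
        ((Y.card : ℝ) / (Fintype.card U : ℝ)) * (((Xc ∩ Y).card : ℝ) / (Y.card : ℝ)) ^ 2 := by
  have hterm (x y u : ℝ) : y / u * (x / y) ^ 2 = x ^ 2 / y / u := by
    rcases eq_or_ne y 0 with rfl | hy
    · simp
    · field_simp
  simp only [hterm]
  have h : Q' ≤ Q := fun B hB ↦ href B hB
  rw [← Finpartition.sum_sum_filter_subset_of_le h]
  refine sum_le_sum fun Y hY ↦ ?_
  rw [sum_comm]
  refine sum_le_sum fun X _ ↦ ?_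
  rw [← sum_div]
  gcongr
  exact Finpartition.sq_card_inter_div_card_le_of_le h hY X
end
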